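/- Let m ≥ 1, let f : ℂ^m → ℂ be a nonconstant entire function, let u ∈ ℂ^m be a unit vector, and let k, n be positive integers with n ≥ k + 1 such that ∂_u^k(f^n) is not identically zero. If f^n and ∂_u^k(f^n) share the value 1 CM, then there exists c ∈ ℂ \ {0} with (c/n)^k = 1 such that f = c·∂_u f identically on ℂ^m. (Paper's Theorem 2.1.) -/

import Mathlib

/-- The directional derivative of `f : ℂ^m → ℂ` along the direction `u`. -/
noncomputable def dirDeriv {m : ℕ} (u : Fin m → ℂ) (f : (Fin m → ℂ) → ℂ) :
    (Fin m → ℂ) → ℂ :=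
  fun z => fderiv ℂ f z u

open Metric Set Filter Topology Real in
/-- Lower Harnack inequality on a disc. -/
theorem harnack_lower {u : ℂ → ℝ} {c w : ℂ} {R : ℝ}
    (hu : InnerProductSpace.HarmonicContOnCl u (ball c R))
    (h0 : ∀ z ∈ sphere c R, 0 ≤ u z) (hw : w ∈ ball c R) :
    (R - ‖w - c‖) / (R + ‖w - c‖) * u c ≤ u w := by
  have hR : 0 < R := pos_of_mem_ball hw
  have hcl : ContinuousOn u (sphere c |R|) := by
    refine hu.2.mono ?_
    rw [closure_ball c hR.ne', abs_of_pos hR]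
    exact sphere_subset_closedBall
  rw [← hu.circleAverage_re_herglotzRieszKernel_smul hw,
    ← (by simpa [abs_of_pos hR] using
      InnerProductSpace.HarmonicContOnCl.circleAverage_eq (by simpa [abs_of_pos hR] using hu) :
      circleAverage u c R = u c), ← smul_eq_mul, ← circleAverage_fun_smul]
  refine circleAverage_mono ?_ ?_ ?_
  · exact (continuousOn_const.mul hcl).circleIntegrable'
  · refine (ContinuousOn.smul ?_ hcl).circleIntegrable'
    exact Complex.continuous_re.comp_continuousOn (continuousOn_herglotzRieszKernel_sphere hw)
  · intro z hz
    rw [abs_of_pos hR] at hz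
    simp only [smul_eq_mul, Pi.smul_apply', Function.comp, herglotzRieszKernel_def]
    exact mul_le_mul_of_nonneg_right (le_re_herglotzRieszKernel hz hw) (h0 z hz)

open Metric Set Filter Topology Real in
/-- Upper bound of a harmonic function by the mean of its modulus. -/
theorem harmonic_le_circleAverage_abs {u : ℂ → ℝ} {c w : ℂ} {R : ℝ}
    (hu : InnerProductSpace.HarmonicContOnCl u (ball c R)) (hw : w ∈ ball c R) :
    u w ≤ (R + ‖w - c‖) / (R - ‖w - c‖) * circleAverage (fun z => |u z|) c R := by
  have hR : 0 < R := pos_of_mem_ball hw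
  have hcl : ContinuousOn u (sphere c |R|) := by
    refine hu.2.mono ?_
    rw [closure_ball c hR.ne', abs_of_pos hR]
    exact sphere_subset_closedBall
  rw [← hu.circleAverage_re_herglotzRieszKernel_smul hw, ← smul_eq_mul,
    ← circleAverage_fun_smul]
  refine circleAverage_mono ?_ ?_ ?_
  · refine (ContinuousOn.smul ?_ hcl).circleIntegrable'
    exact Complex.continuous_re.comp_continuousOn (continuousOn_herglotzRieszKernel_sphere hw)
  · exact (continuousOn_const.mul hcl.abs).circleIntegrable'
  · intro z hz
    rw [abs_of_pos hR] at hz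
    simp only [smul_eq_mul, Pi.smul_apply', Function.comp, herglotzRieszKernel_def]
    have h1 := re_herglotzRieszKernel_le hz hw
    have h2 := le_re_herglotzRieszKernel hz hw
    have h3 : 0 ≤ (R - ‖w - c‖) / (R + ‖w - c‖) := by
      have := mem_ball_iff_norm.1 hw
      apply div_nonneg <;> [linarith; positivity]
    calc _ ≤ ((z - c + (w - c)) / ((z - c) - (w - c))).re * |u z| :=
          mul_le_mul_of_nonneg_left (le_abs_self _) (h3.trans h2)
      _ ≤ _ := mul_le_mul_of_nonneg_right h1 (abs_nonneg _)

open Metric Set Filter Topology in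
/-- If `g` is entire, `‖g z₁‖ ≤ 1`, and `‖g'‖ ≤ K` at the points near `z` where `‖g‖ = 1`,
then `‖g z‖` is at most exponential in `‖z - z₁‖`. -/
theorem norm_le_exp_of_norm_deriv_le {g : ℂ → ℂ} (hg : Differentiable ℂ g) {K : ℝ} (hK : 0 ≤ K)
    {z z₁ : ℂ} (h1 : ‖g z₁‖ ≤ 1)
    (hd : ∀ ζ ∈ closedBall z ‖z - z₁‖, ‖g ζ‖ = 1 → ‖deriv g ζ‖ ≤ K) :
    ‖g z‖ ≤ Real.exp (2 * K * ‖z - z₁‖) := by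
  by_cases hz : ‖g z‖ ≤ 1
  · exact hz.trans (Real.one_le_exp (by positivity))
  push Not at hz
  have hclosed : IsClosed {w | ‖g w‖ ≤ 1} := isClosed_le hg.continuous.norm continuous_const
  obtain ⟨ζ, hζ, hζd⟩ := hclosed.exists_infDist_eq_dist ⟨z₁, h1⟩ z
  set δ := dist z ζ with hδ
  have hδle : δ ≤ ‖z - z₁‖ := by
    rw [← hζd, ← dist_eq_norm]; exact infDist_le_dist_of_mem h1
  have hne : z ≠ ζ := by rintro rfl; exact absurd hζ (not_le.2 hz)
  have hδ0 : 0 < δ := dist_pos.2 hne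
  have hin : ∀ w ∈ ball z δ, 1 < ‖g w‖ := by
    intro w hw
    by_contra! hcon
    have : infDist z {w | ‖g w‖ ≤ 1} ≤ dist z w := infDist_le_dist_of_mem hcon
    rw [mem_ball, dist_comm] at hw
    linarith
  have hcl : ∀ w ∈ closedBall z δ, 1 ≤ ‖g w‖ := by
    intro w hw
    rw [← closure_ball z hδ0.ne'] at hw
    have : closure (ball z δ) ⊆ {w | 1 ≤ ‖g w‖} :=
      closure_minimal (fun w hw => (hin w hw).le) (isClosed_le continuous_const hg.continuous.norm)
    exact this hw
  have hζ1 : ‖g ζ‖ = 1 := le_antisymm hζ (hcl ζ (by simp [hδ, dist_comm]))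
  have hdζ : ‖deriv g ζ‖ ≤ K := hd ζ (by rw [mem_closedBall, dist_comm]; exact hδle) hζ1
  have harm : InnerProductSpace.HarmonicContOnCl (fun w => Real.log ‖g w‖) (ball z δ) := by
    refine ⟨fun w hw => ?_, ?_⟩
    · exact (hg.analyticAt w).harmonicAt_log_norm (by
        rw [← norm_pos_iff]; linarith [hin w hw])
    · rw [closure_ball z hδ0.ne']
      exact hg.continuous.norm.continuousOn.log fun w hw => by linarith [hcl w hw]
  set q := Real.log ‖g z‖ with hq
  have hq0 : 0 < q := Real.log_pos hz
  -- compare along the segment from `z` to `ζ`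
  have key : ∀ t ∈ Ioo (0 : ℝ) 1, q / 2 ≤ t⁻¹ * (‖g (ζ + t • (z - ζ))‖ - ‖g ζ‖) := by
    intro t ht
    have hn : ‖ζ + t • (z - ζ) - z‖ = δ * (1 - t) := by
      have : ζ + t • (z - ζ) - z = (((1 - t : ℝ)) : ℂ) * (ζ - z) := by
        simp only [Complex.real_smul]; push_cast; ring
      rw [this, norm_mul, Complex.norm_real, Real.norm_of_nonneg (by linarith [ht.2]), hδ,
        dist_eq_norm, ← norm_neg (ζ - z), neg_sub, mul_comm]
    have hmem : ζ + t • (z - ζ) ∈ ball z δ := by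
      rw [mem_ball_iff_norm, hn]; nlinarith [ht.1]
    have h := harnack_lower harm (fun w hw => Real.log_nonneg (hcl w (sphere_subset_closedBall hw)))
      hmem
    rw [hn] at h
    have h2 : t / 2 * q ≤ (δ - δ * (1 - t)) / (δ + δ * (1 - t)) * q := by
      refine mul_le_mul_of_nonneg_right ?_ hq0.le
      rw [div_le_div_iff₀ (by norm_num) (by nlinarith [ht.2])]
      nlinarith [ht.1, ht.2, mul_pos hδ0 ht.1, mul_pos (mul_pos hδ0 ht.1) ht.1]
    have h3 := Real.log_le_sub_one_of_pos (x := ‖g (ζ + t • (z - ζ))‖) (by linarith [hin _ hmem])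
    rw [hζ1, inv_mul_eq_div, le_div_iff₀ ht.1]
    linarith
  have hlim : Tendsto (fun t : ℝ => ‖t⁻¹ • (g (ζ + t • (z - ζ)) - g ζ)‖) (𝓝[>] 0)
      (𝓝 ‖deriv g ζ * (z - ζ)‖) := by
    have h1 : HasDerivAt (fun t : ℝ => g (ζ + t • (z - ζ))) (deriv g ζ * (z - ζ)) 0 := by
      have ha : HasDerivAt (fun t : ℝ => ζ + t • (z - ζ)) (z - ζ) 0 := by
        simpa using ((hasDerivAt_id (0 : ℝ)).smul_const (z - ζ)).const_add ζ
      have hb : HasDerivAt g (deriv g ζ) (ζ + (0 : ℝ) • (z - ζ)) := by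
        simpa using (hg ζ).hasDerivAt
      exact hb.comp (0 : ℝ) ha
    have h2 := h1.tendsto_slope_zero_right
    simpa using h2.norm
  have hfin : q / 2 ≤ ‖deriv g ζ * (z - ζ)‖ := by
    refine ge_of_tendsto hlim ?_
    filter_upwards [Ioo_mem_nhdsGT (show (0 : ℝ) < 1 by norm_num)] with t ht
    refine (key t ht).trans ?_
    rw [norm_smul, Real.norm_of_nonneg (inv_nonneg.2 ht.1.le)]
    exact mul_le_mul_of_nonneg_left (norm_sub_norm_le _ _) (inv_nonneg.2 ht.1.le)
  rw [← Real.log_le_iff_le_exp (by linarith), ← hq]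
  rw [norm_mul, ← dist_eq_norm z ζ, ← hδ] at hfin
  nlinarith [mul_le_mul hdζ hδle hδ0.le hK]

open Metric Set Filter Topology in
/-- An entire function of linear growth is affine. -/
theorem exists_affine_of_norm_le {h : ℂ → ℂ} (hh : Differentiable ℂ h) {A B : ℝ}
    (hb : ∀ z, ‖h z‖ ≤ A + B * ‖z‖) : ∃ a b : ℂ, ∀ z, h z = a * z + b := by
  have hA : 0 ≤ A := by simpa using (norm_nonneg _).trans (hb 0)
  have hdb : ∀ z, ‖deriv h z‖ ≤ A + 2 * |B| := by
    intro z
    have hr : 0 < 1 + ‖z‖ := by positivity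
    refine (Complex.norm_deriv_le_of_forall_mem_sphere_norm_le (C := A + |B| * (1 + 2 * ‖z‖))
      hr hh.diffContOnCl fun w hw => ?_).trans ?_
    · refine (hb w).trans ?_
      have h1 : ‖w‖ ≤ 1 + 2 * ‖z‖ := by
        have := norm_le_norm_sub_add w z
        rw [mem_sphere_iff_norm] at hw
        linarith
      nlinarith [le_abs_self B, norm_nonneg w, abs_nonneg B, mul_le_mul_of_nonneg_left h1 (abs_nonneg B),
        mul_le_mul_of_nonneg_right (le_abs_self B) (norm_nonneg w)]
    · rw [div_le_iff₀ hr]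
      nlinarith [norm_nonneg z, abs_nonneg B, mul_nonneg hA (norm_nonneg z)]
  have hd : Differentiable ℂ (deriv h) := hh.deriv
  have hc : ∀ z, deriv h z = deriv h 0 := fun z =>
    hd.apply_eq_apply_of_bounded (isBounded_iff_forall_norm_le.2 ⟨A + 2 * |B|, by
      rintro _ ⟨w, rfl⟩; exact hdb w⟩) z 0
  refine ⟨deriv h 0, h 0, fun z => ?_⟩
  have hk : Differentiable ℂ fun z => h z - deriv h 0 * z := by fun_prop
  have := is_const_of_deriv_eq_zero hk (fun w => by
    have := ((hh w).hasDerivAt.sub ((hasDerivAt_id w).const_mul (deriv h 0))).deriv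
    simp only [id, mul_one, hc w, sub_self] at this
    exact this) z 0
  simp only [mul_zero, sub_zero] at this
  rw [← this]; ring

open Metric Set Filter Topology in
/-- An entire function whose real part has linear growth is affine. -/
theorem exists_affine_of_re_le {h : ℂ → ℂ} (hh : Differentiable ℂ h) {A B : ℝ}
    (hb : ∀ z, (h z).re ≤ A + B * ‖z‖) : ∃ a b : ℂ, ∀ z, h z = a * z + b := by
  refine exists_affine_of_norm_le hh (A := 2 * (|A| + |B| + 1) + 3 * ‖h 0‖)
    (B := 4 * |B|) fun z => ?_
  have hR : 0 < 2 * ‖z‖ + 1 := by positivity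
  have hbc := Complex.borelCaratheodory (R := 2 * ‖z‖ + 1) (f := h) (z := z)
    (M := |A| + |B| * (2 * ‖z‖ + 1) + 1) (by positivity) hh.differentiableOn
    (fun w hw => by
      have hw' : ‖w‖ ≤ 2 * ‖z‖ + 1 := (mem_ball_zero_iff.1 hw).le
      have := mul_le_mul_of_nonneg_left hw' (abs_nonneg B)
      have h2 := mul_le_mul_of_nonneg_right (le_abs_self B) (norm_nonneg w)
      show (h w).re ≤ _
      linarith [hb w, le_abs_self A]) hR (by rw [mem_ball_zero_iff]; linarith [norm_nonneg z])
  have hz := norm_nonneg z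
  have h1 : 2 * ‖z‖ + 1 - ‖z‖ = ‖z‖ + 1 := by ring
  rw [h1] at hbc
  refine hbc.trans ?_
  rw [← add_div, div_le_iff₀ (by positivity)]
  have e1 := abs_nonneg A
  have e2 := abs_nonneg B
  have e3 := norm_nonneg (h 0)
  nlinarith [mul_nonneg e1 hz, mul_nonneg e2 hz, mul_nonneg e3 hz, mul_nonneg e2 (mul_nonneg hz hz)]

/-- A zero-free entire function is the exponential of an entire function. -/
theorem exists_eq_exp {g : ℂ → ℂ} (hg : Differentiable ℂ g) (h0 : ∀ z, g z ≠ 0) :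
    ∃ h : ℂ → ℂ, Differentiable ℂ h ∧ ∀ z, g z = Complex.exp (h z) := by
  have hd : Differentiable ℂ fun z => deriv g z / g z := hg.deriv.div hg h0
  obtain ⟨p, hp⟩ := hd.isExactOn_univ
  have hp' : ∀ z, HasDerivAt p (deriv g z / g z) z := fun z => hp z trivial
  have hpd : Differentiable ℂ p := fun z => (hp' z).differentiableAt
  have hconst : ∀ z, g z * Complex.exp (-p z) = g 0 * Complex.exp (-p 0) := fun z => by
    refine is_const_of_deriv_eq_zero (f := fun z => g z * Complex.exp (-p z)) (by fun_prop)
      (fun w => ?_) z 0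
    have := ((hg w).hasDerivAt.mul (hp' w).neg.cexp).deriv
    simp only [Pi.mul_def, Pi.neg_def] at this
    rw [this]
    field_simp [h0 w]
    ring
  refine ⟨fun z => p z + Complex.log (g 0 * Complex.exp (-p 0)), by fun_prop, fun z => ?_⟩
  rw [Complex.exp_add, Complex.exp_log (mul_ne_zero (h0 0) (Complex.exp_ne_zero _)), ← hconst z,
    Complex.exp_neg]
  field_simp [Complex.exp_ne_zero]

/-- A zero-free entire function of exponential type is the exponential of an affine function. -/
theorem exists_eq_exp_affine {g : ℂ → ℂ} (hg : Differentiable ℂ g)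
    (h0 : ∀ z, g z ≠ 0) {C B : ℝ} (hb : ∀ z, ‖g z‖ ≤ C * Real.exp (B * ‖z‖)) :
    ∃ a b : ℂ, ∀ z, g z = Complex.exp (a * z + b) := by
  obtain ⟨h, hh, hgh⟩ := exists_eq_exp hg h0
  have hC : 0 < C := by
    have := (norm_pos_iff.2 (h0 0)).trans_le (hb 0)
    simpa using this
  obtain ⟨a, b, hab⟩ := exists_affine_of_re_le hh (A := Real.log C) (B := B) fun z => by
    have := hb z
    rw [hgh, Complex.norm_exp] at this
    rwa [← Real.exp_log hC, ← Real.exp_add, Real.exp_le_exp] at this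
  exact ⟨a, b, fun z => by rw [hgh, hab]⟩

open Metric Set Filter Topology in
/-- Hurwitz: zeros of a nonconstant limit are limits of zeros. -/
theorem eventually_exists_zero_of_tendstoLocallyUniformlyOn {ι : Type*} {l : Filter ι}
    {H : ι → ℂ → ℂ} {G : ℂ → ℂ} (hH : ∀ i, Differentiable ℂ (H i)) (hG : Differentiable ℂ G)
    (hlim : TendstoLocallyUniformlyOn H G l univ) {z₀ z₁ : ℂ} (h0 : G z₀ = 0) (h1 : G z₁ ≠ 0)
    {r : ℝ} (hr : 0 < r) : ∀ᶠ i in l, ∃ z ∈ closedBall z₀ r, H i z = 0 := by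
  have hev : ∀ᶠ z in 𝓝[≠] z₀, G z ≠ 0 := by
    rcases (hG.analyticAt z₀).eventually_eq_zero_or_eventually_ne_zero with h | h
    · exfalso
      have : EqOn G 0 univ := (show AnalyticOnNhd ℂ G univ from fun z _ => hG.analyticAt z)
        |>.eqOn_zero_of_preconnected_of_eventuallyEq_zero isPreconnected_univ (mem_univ z₀) h
      exact h1 (this (mem_univ z₁))
    · exact h
  obtain ⟨ρ, hρ, hρ'⟩ := Metric.mem_nhdsWithin_iff.1 hev
  set s := min r (ρ / 2) with hs
  have hs0 : 0 < s := by positivity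
  have hsph : ∀ z ∈ sphere z₀ s, G z ≠ 0 := by
    intro z hz
    refine hρ' ⟨?_, ?_⟩
    · rw [mem_ball, mem_sphere.1 hz]; linarith [min_le_right r (ρ / 2)]
    · rintro rfl; simp at hz; linarith
  obtain ⟨w, hw, hmin⟩ := (isCompact_sphere z₀ s).exists_isMinOn
    (NormedSpace.sphere_nonempty.2 hs0.le) hG.continuous.norm.continuousOn
  set ε := ‖G w‖
  have hε : 0 < ε := norm_pos_iff.2 (hsph w hw)
  have hunif : TendstoUniformlyOn H G l (closedBall z₀ s) :=
    (tendstoLocallyUniformlyOn_iff_forall_isCompact isOpen_univ).1 hlim _ (subset_univ _)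
      (isCompact_closedBall _ _)
  filter_upwards [Metric.tendstoUniformlyOn_iff.1 hunif (ε / 8) (by positivity)] with i hi
  have hc : ‖H i z₀‖ < ε / 8 := by
    have := hi z₀ (mem_closedBall_self hs0.le)
    rwa [h0, dist_zero_left] at this
  have hb : ∀ z ∈ sphere z₀ s, ε / 2 ≤ ‖H i z - H i z₀‖ := by
    intro z hz
    have h2 := hi z (sphere_subset_closedBall hz)
    have h3 : ε ≤ ‖G z‖ := hmin hz
    rw [dist_eq_norm] at h2
    have h4 := norm_sub_norm_le (G z) (H i z)
    have h5 := norm_sub_norm_le (H i z) (H i z₀)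
    linarith
  have hfreq : ∃ᶠ z in 𝓝 z₀, H i z ≠ H i z₀ := by
    intro hcon
    have heq : EqOn (H i) (fun _ => H i z₀) univ :=
      (show AnalyticOnNhd ℂ (H i) univ from fun z _ => (hH i).analyticAt z)
        |>.eqOn_of_preconnected_of_eventuallyEq analyticOnNhd_const
        isPreconnected_univ (mem_univ z₀) (by filter_upwards [hcon] with z hz using by simpa using hz)
    have := hb w hw
    rw [heq (mem_univ w)] at this
    simp at this
    linarith
  have := (hH i).diffContOnCl.ball_subset_image_closedBall hs0 hb hfreq
  obtain ⟨z, hz, hz0⟩ := this (show (0 : ℂ) ∈ ball (H i z₀) (ε / 2 / 2) by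
    rw [mem_ball, dist_zero_left]; linarith)
  exact ⟨z, closedBall_subset_closedBall (min_le_left _ _) hz, hz0⟩

open Metric Set Filter Topology in
/-- Montel's theorem along an ultrafilter. -/
theorem exists_tendstoLocallyUniformlyOn_of_bounded {ι : Type*} (l : Ultrafilter ι)
    {H : ι → ℂ → ℂ} (hH : ∀ i, Differentiable ℂ (H i))
    (hb : ∀ R : ℝ, ∃ M : ℝ, ∀ᶠ i in (l : Filter ι), ∀ z ∈ closedBall (0 : ℂ) R, ‖H i z‖ ≤ M) :
    ∃ G : ℂ → ℂ, Differentiable ℂ G ∧ TendstoLocallyUniformlyOn H G l univ := by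
  have hpt : ∀ z, ∃ y, Tendsto (fun i => H i z) l (𝓝 y) := by
    intro z
    obtain ⟨M, hM⟩ := hb ‖z‖
    have : ∀ᶠ i in (l : Filter ι), H i z ∈ closedBall (0 : ℂ) M := by
      filter_upwards [hM] with i hi using mem_closedBall_zero_iff.2 (hi z (by simp))
    obtain ⟨y, -, hy⟩ := (isCompact_closedBall (0 : ℂ) M).ultrafilter_le_nhds
      (l.map fun i => H i z) (le_principal_iff.2 this)
    exact ⟨y, hy⟩
  choose G hG using hpt
  have hlim : TendstoLocallyUniformlyOn H G l univ := by
    rw [Metric.tendstoLocallyUniformlyOn_iff]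
    intro ε hε x _
    obtain ⟨M, hM⟩ := hb (‖x‖ + 2)
    set C := |M| + 1 with hC
    have hC0 : 0 < C := by positivity
    have hlip : ∀ᶠ i in (l : Filter ι), ∀ y ∈ ball x 1, ‖H i y - H i x‖ ≤ C * ‖y - x‖ := by
      filter_upwards [hM] with i hi y hy
      refine (convex_ball x 1).norm_image_sub_le_of_norm_deriv_le (fun z _ => hH i z)
        (fun z hz => ?_) (mem_ball_self one_pos) hy
      have := Complex.norm_deriv_le_of_forall_mem_sphere_norm_le (C := M) one_pos
        ((hH i).diffContOnCl (s := ball z 1)) fun w hw => hi w (by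
          rw [mem_closedBall_zero_iff]
          rw [mem_ball_iff_norm] at hz
          rw [mem_sphere_iff_norm] at hw
          have h1 := norm_le_norm_sub_add w z
          have h2 := norm_le_norm_sub_add z x
          linarith)
      rw [div_one] at this
      linarith [le_abs_self M]
    have hlipG : ∀ y ∈ ball x 1, ‖G y - G x‖ ≤ C * ‖y - x‖ := fun y hy =>
      le_of_tendsto ((hG y).sub (hG x)).norm (by filter_upwards [hlip] with i hi using hi y hy)
    refine ⟨ball x (min 1 (ε / (3 * C))), mem_nhdsWithin_of_mem_nhds (ball_mem_nhds _ (by positivity)), ?_⟩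
    filter_upwards [hlip, Metric.tendsto_nhds.1 (hG x) (ε / 3) (by positivity)] with i h1 h2 y hy
    have hy1 : y ∈ ball x 1 := ball_subset_ball (min_le_left _ _) hy
    have hy2 : ‖y - x‖ < ε / (3 * C) := mem_ball_iff_norm.1 (ball_subset_ball (min_le_right _ _) hy)
    have hy3 : C * ‖y - x‖ < ε / 3 := by
      rw [lt_div_iff₀ (by positivity)] at hy2
      linarith
    have h3 := h1 y hy1
    have h4 := hlipG y hy1
    rw [dist_eq_norm] at h2 ⊢
    calc ‖G y - H i y‖ = ‖(G y - G x) - (H i x - G x) - (H i y - H i x)‖ := by congr 1; ring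
      _ ≤ ‖G y - G x‖ + ‖H i x - G x‖ + ‖H i y - H i x‖ :=
        (norm_sub_le _ _).trans (add_le_add_left (norm_sub_le _ _) _)
      _ < ε := by linarith
  exact ⟨G, differentiableOn_univ.1 (hlim.differentiableOn
    (Eventually.of_forall fun i => (hH i).differentiableOn) isOpen_univ), hlim⟩

open Set Filter in
theorem iteratedDeriv_tendstoLocallyUniformlyOn {ι : Type*} {l : Filter ι} {H : ι → ℂ → ℂ}
    {G : ℂ → ℂ} (hH : ∀ i, Differentiable ℂ (H i)) (hlim : TendstoLocallyUniformlyOn H G l univ)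
    (k : ℕ) : TendstoLocallyUniformlyOn (fun i => iteratedDeriv k (H i)) (iteratedDeriv k G) l
      univ := by
  induction k with
  | zero => simpa [iteratedDeriv_zero] using hlim
  | succ k ih =>
    simp only [iteratedDeriv_succ]
    exact ih.deriv (Eventually.of_forall fun i =>
      ((hH i).contDiff.differentiable_iteratedDeriv k
        (by exact_mod_cast WithTop.coe_lt_top _)).differentiableOn) isOpen_univ

open Metric Set Filter Topology in
/-- Zalcman rescaling at the level set `‖g‖ = 1`. -/
theorem exists_rescaling {g : ℂ → ℂ} (hg : Differentiable ℂ g)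
    (hunb : ∀ K : ℝ, ∃ ζ, ‖g ζ‖ = 1 ∧ K < ‖deriv g ζ‖) (j : ℕ) :
    ∃ (z : ℂ) (ρ : ℝ), 0 < ρ ∧ ρ * (j + 1) ≤ 1 ∧ ρ * ‖deriv g z‖ = 1 ∧
      ∀ w : ℂ, 4 * ‖w‖ ≤ j + 1 → ‖g (z + ρ * w)‖ ≤ Real.exp (4 * ‖w‖) := by
  obtain ⟨ζ, hζ, hζd⟩ := hunb (j + 1)
  have hcomp : IsCompact (closedBall ζ 1 ∩ {z | ‖g z‖ = 1}) :=
    (isCompact_closedBall ζ 1).inter_right (isClosed_eq hg.continuous.norm continuous_const)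
  have hgd : Continuous (deriv g) := hg.deriv.continuous
  obtain ⟨z, ⟨hz, hz1⟩, hmax⟩ := hcomp.exists_isMaxOn ⟨ζ, by simp, hζ⟩
    (f := fun z => (1 - ‖z - ζ‖) * ‖deriv g z‖) (by fun_prop)
  set M := (1 - ‖z - ζ‖) * ‖deriv g z‖ with hM
  have hMj : (j + 1 : ℝ) < M := by
    have : (1 - ‖ζ - ζ‖) * ‖deriv g ζ‖ ≤ M := hmax ⟨by simp, hζ⟩
    simp only [sub_self, norm_zero, sub_zero, one_mul] at this
    linarith
  have hj : (0 : ℝ) ≤ j := j.cast_nonneg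
  have hd0 : 0 < ‖deriv g z‖ := by
    rcases (norm_nonneg (deriv g z)).eq_or_lt with h | h
    · rw [hM, ← h] at hMj; linarith
    · exact h
  set ρ := ‖deriv g z‖⁻¹ with hρ
  have hρ0 : 0 < ρ := inv_pos.2 hd0
  have hMρ : 1 - ‖z - ζ‖ = M * ρ := by rw [hM, hρ]; field_simp
  refine ⟨z, ρ, hρ0, ?_, inv_mul_cancel₀ hd0.ne', fun w hw => ?_⟩
  · nlinarith [norm_nonneg (z - ζ)]
  have hH : Differentiable ℂ fun w : ℂ => g (z + ρ * w) := by fun_prop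
  have hHd : ∀ w : ℂ, deriv (fun w : ℂ => g (z + ρ * w)) w = deriv g (z + ρ * w) * ρ := fun w => by
    have h1 : HasDerivAt (fun w : ℂ => z + ρ * w) (ρ : ℂ) w := by
      simpa using ((hasDerivAt_id w).const_mul (ρ : ℂ)).const_add z
    exact ((hg _).hasDerivAt.comp w h1).deriv
  have := norm_le_exp_of_norm_deriv_le hH (K := 2) (by norm_num) (z := w) (z₁ := 0)
    (by simpa using hz1.le) fun v hv hv1 => by
      rw [hHd, norm_mul, Complex.norm_real, Real.norm_of_nonneg hρ0.le]
      have hvn : ‖v‖ ≤ M / 2 := by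
        rw [mem_closedBall_iff_norm, sub_zero] at hv
        have := norm_le_norm_sub_add v w
        linarith
      have hdist : ‖z + ρ * v - ζ‖ ≤ ‖z - ζ‖ + ρ * ‖v‖ := by
        calc ‖z + ρ * v - ζ‖ = ‖(z - ζ) + ρ * v‖ := by congr 1; ring
          _ ≤ _ := (norm_add_le _ _).trans (by
            rw [norm_mul, Complex.norm_real, Real.norm_of_nonneg hρ0.le])
      have hlow : M * ρ / 2 ≤ 1 - ‖z + ρ * v - ζ‖ := by nlinarith
      have hmx : (1 - ‖z + ρ * v - ζ‖) * ‖deriv g (z + ρ * v)‖ ≤ M := by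
        refine hmax ⟨?_, hv1⟩
        rw [mem_closedBall_iff_norm]
        nlinarith [mul_pos (show 0 < M by linarith) hρ0]
      have h5 := (mul_le_mul_of_nonneg_right hlow (norm_nonneg (deriv g (z + ρ * v)))).trans hmx
      have hM0 : 0 < M := by linarith
      by_contra! hcon
      nlinarith [mul_lt_mul_of_pos_left hcon hM0]
  simpa [show (2 : ℝ) * 2 = 4 by norm_num] using this

/-- Low-order derivatives of `g ^ n` are divisible by `g`. -/
theorem iteratedDeriv_pow_eq_zero {g : ℂ → ℂ} (hg : Differentiable ℂ g) {n i : ℕ} (hi : i < n)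
    {z : ℂ} (hz : g z = 0) : iteratedDeriv i (fun w => g w ^ n) z = 0 := by
  have key : ∀ i ≤ n, ∃ p : ℂ → ℂ, Differentiable ℂ p ∧
      iteratedDeriv i (fun w => g w ^ n) = fun w => g w ^ (n - i) * p w := by
    intro i
    induction i with
    | zero => exact fun _ => ⟨fun _ => 1, by fun_prop, by simp [iteratedDeriv_zero]⟩
    | succ i ih =>
      intro hi
      obtain ⟨p, hp, hpe⟩ := ih (by omega)
      refine ⟨fun w => (n - i : ℕ) * deriv g w * p w + g w * deriv p w, ?_, ?_⟩
      · have := hg.deriv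
        have := hp.deriv
        fun_prop
      · rw [iteratedDeriv_succ, hpe]
        funext w
        have := (((hg w).hasDerivAt.fun_pow (n - i)).mul (hp w).hasDerivAt).deriv
        simp only [Pi.mul_def] at this
        rw [this, show n - i = n - (i + 1) + 1 by omega]
        simp only [Nat.add_sub_cancel, pow_succ]
        ring
  obtain ⟨p, -, hp⟩ := key i hi.le
  rw [hp]
  simp [hz, show n - i ≠ 0 by omega]

open Set in
/-- An entire function whose derivatives all vanish at a point is zero. -/
theorem eq_zero_of_iteratedDeriv_eq_zero {F : ℂ → ℂ} (hF : Differentiable ℂ F) {z₀ : ℂ}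
    (h : ∀ i, iteratedDeriv i F z₀ = 0) (z : ℂ) : F z = 0 := by
  have := Complex.taylorSeries_eq_of_entire' z₀ z hF
  rw [← this]
  simp [h]

theorem iteratedDeriv_cexp_affine (k : ℕ) (a b z : ℂ) :
    iteratedDeriv k (fun w => Complex.exp (a * w + b)) z = a ^ k * Complex.exp (a * z + b) := by
  have : (fun w => Complex.exp (a * w + b)) = fun w => Complex.exp b * Complex.exp (a * w) := by
    funext w; rw [Complex.exp_add, mul_comm]
  rw [this, iteratedDeriv_const_mul_field, iteratedDeriv_cexp_const_mul, Complex.exp_add]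
  ring

open Metric Set Filter Topology in
/-- If every zero of `A i` is a zero of `B i`, then every zero of the limit of `A` is a zero of
the limit of `B`, unless the limit of `A` is constant zero. -/
theorem eq_zero_of_tendstoLocallyUniformlyOn {ι : Type*} {l : Filter ι} [l.NeBot]
    {A B : ι → ℂ → ℂ} {a b : ℂ → ℂ} (hA : ∀ i, Differentiable ℂ (A i)) (ha : Differentiable ℂ a)
    (hb : Continuous b) (hAa : TendstoLocallyUniformlyOn A a l univ)
    (hBb : TendstoLocallyUniformlyOn B b l univ) (hAB : ∀ i z, A i z = 0 → B i z = 0)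
    {z₀ z₁ : ℂ} (h0 : a z₀ = 0) (h1 : a z₁ ≠ 0) : b z₀ = 0 := by
  by_contra hne
  have hε : 0 < ‖b z₀‖ / 2 := by positivity
  obtain ⟨t, ht, hBt⟩ := Metric.tendstoLocallyUniformlyOn_iff.1 hBb _ hε z₀ (mem_univ _)
  rw [nhdsWithin_univ] at ht
  obtain ⟨r, hr, hrt⟩ := nhds_basis_closedBall.mem_iff.1
    (inter_mem ht (Metric.tendsto_nhds.1 hb.continuousAt _ hε))
  obtain ⟨i, hi, z, hz, hz0⟩ := (hBt.and
    (eventually_exists_zero_of_tendstoLocallyUniformlyOn hA ha hAa h0 h1 hr)).exists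
  have h2 := hi z (hrt hz).1
  have h3 : dist (b z) (b z₀) < ‖b z₀‖ / 2 := (hrt hz).2
  rw [hAB i z hz0, dist_zero_right] at h2
  rw [dist_eq_norm, norm_sub_rev] at h3
  linarith [norm_le_norm_sub_add (b z₀) (b z)]

theorem tendstoLocallyUniformlyOn_const {ι α β : Type*} [TopologicalSpace α] [UniformSpace β]
    {l : Filter ι} {c : ι → β} {b : β} (h : Filter.Tendsto c l (nhds b)) (s : Set α) :
    TendstoLocallyUniformlyOn (fun i _ => c i) (fun _ => b) l s := by
  intro v hv x _
  refine ⟨Set.univ, Filter.univ_mem, ?_⟩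
  filter_upwards [Uniform.tendsto_nhds_right.1 h hv] with i hi y _ using hi

theorem TendstoLocallyUniformlyOn.pow_of_continuousOn {ι α : Type*} [TopologicalSpace α]
    {l : Filter ι} {H : ι → α → ℂ} {G : α → ℂ} {s : Set α}
    (hlim : TendstoLocallyUniformlyOn H G l s) (hG : ContinuousOn G s) (n : ℕ) :
    TendstoLocallyUniformlyOn (fun i w => H i w ^ n) (fun w => G w ^ n) l s := by
  induction n with
  | zero => simpa using tendstoLocallyUniformlyOn_const tendsto_const_nhds s
  | succ n ih =>
    simp only [pow_succ]
    exact ih.mul₀ hlim (hG.pow n) hG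

theorem iteratedDeriv_comp_affine {F : ℂ → ℂ} (hF : Differentiable ℂ F) (k : ℕ) (z c w : ℂ) :
    iteratedDeriv k (fun w => F (z + c * w)) w = c ^ k * iteratedDeriv k F (z + c * w) := by
  have h := iteratedDeriv_comp_const_mul (n := k) (f := fun w => F (z + w))
    ((hF.comp (differentiable_id.const_add z)).contDiff) c
  rw [iteratedDeriv_comp_const_add] at h
  exact congrFun h w

open Metric Set Filter Topology in
/-- If `g ^ n` and its `k`-th derivative take the value `1` at the same points, `k < n`, then
`g'` is bounded on the set where `‖g‖ = 1`. -/
theorem exists_norm_deriv_le_of_share_one {g : ℂ → ℂ} (hg : Differentiable ℂ g) {k n : ℕ}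
    (hk : 1 ≤ k) (hn : k < n)
    (hs : ∀ z, iteratedDeriv k (fun w => g w ^ n) z = 1 ↔ g z ^ n = 1) :
    ∃ K, ∀ ζ, ‖g ζ‖ = 1 → ‖deriv g ζ‖ ≤ K := by
  by_contra! hunb
  choose z ρ hρ hρj hρd hgb using exists_rescaling hg hunb
  have hn0 : n ≠ 0 := by omega
  have hF : Differentiable ℂ fun w => g w ^ n := hg.pow n
  set H : ℕ → ℂ → ℂ := fun j w => g (z j + ρ j * w) with hH_def
  have hH : ∀ j, Differentiable ℂ (H j) := fun j => by fun_prop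
  have hle : ((hyperfilter ℕ : Ultrafilter ℕ) : Filter ℕ) ≤ atTop := by
    rw [← Nat.cofinite_eq_atTop]; exact hyperfilter_le_cofinite
  have hρ0 : Tendsto (fun j => (ρ j : ℂ)) (hyperfilter ℕ : Ultrafilter ℕ) (𝓝 0) := by
    have : Tendsto ρ atTop (𝓝 0) := by
      refine squeeze_zero (fun j => (hρ j).le) (fun j => ?_) tendsto_one_div_add_atTop_nhds_zero_nat
      rw [le_div_iff₀ (by positivity)]
      exact hρj j
    have := (Complex.continuous_ofReal.tendsto 0).comp (this.mono_left hle)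
    simpa [Function.comp_def] using this
  have hHb : ∀ w : ℂ, ∀ᶠ j : ℕ in ((hyperfilter ℕ : Ultrafilter ℕ) : Filter ℕ),
      4 * ‖w‖ ≤ (j : ℝ) + 1 := fun w =>
    hle ((eventually_ge_atTop ⌈4 * ‖w‖⌉₊).mono fun j hj => by
      have := Nat.ceil_le.1 hj
      linarith)
  obtain ⟨G, hG, hlim⟩ := exists_tendstoLocallyUniformlyOn_of_bounded (hyperfilter ℕ) hH
    fun R => ⟨Real.exp (4 * |R|), by
      filter_upwards [hHb (|R| : ℝ)] with j hj w hw
      have hw' : ‖w‖ ≤ |R| := (mem_closedBall_zero_iff.1 hw).trans (le_abs_self R)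
      have hR : ‖((|R| : ℝ) : ℂ)‖ = |R| := by simp
      rw [hR] at hj
      exact (hgb j w (by linarith)).trans (Real.exp_le_exp.2 (by linarith))⟩
  have hGb : ∀ w, ‖G w‖ ≤ Real.exp (4 * ‖w‖) := fun w => by
    refine le_of_tendsto (hlim.tendsto_at (mem_univ w)).norm ?_
    filter_upwards [hHb w] with j hj using hgb j w hj
  have hGd : ‖deriv G 0‖ = 1 := by
    have h1 := ((iteratedDeriv_tendstoLocallyUniformlyOn hH hlim 1).tendsto_at (mem_univ 0)).norm
    simp only [iteratedDeriv_one] at h1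
    refine tendsto_nhds_unique h1 (tendsto_const_nhds.congr fun j => ?_)
    have := iteratedDeriv_comp_affine hg 1 (z j) (ρ j) 0
    simp only [iteratedDeriv_one, mul_zero, add_zero, pow_one] at this
    rw [hH_def]
    simp only
    rw [this, norm_mul, Complex.norm_real, Real.norm_of_nonneg (hρ j).le, hρd]
  have hGnc : ∀ c, ¬ ∀ w, G w = c := fun c hc => by
    have : G = fun _ => c := funext hc
    rw [this] at hGd
    simp at hGd
  have hQ : ∀ j, Differentiable ℂ fun w => H j w ^ n := fun j => (hH j).pow n
  have hGn : Differentiable ℂ fun w => G w ^ n := hG.pow n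
  have hQlim : TendstoLocallyUniformlyOn (fun j w => H j w ^ n) (fun w => G w ^ n)
      (hyperfilter ℕ : Ultrafilter ℕ) univ := hlim.pow_of_continuousOn hG.continuous.continuousOn n
  have hQd := iteratedDeriv_tendstoLocallyUniformlyOn hQ hQlim k
  have hQv : ∀ j w, iteratedDeriv k (fun w => H j w ^ n) w =
      ρ j ^ k * iteratedDeriv k (fun w => g w ^ n) (z j + ρ j * w) := fun j w =>
    iteratedDeriv_comp_affine hF k (z j) (ρ j) w
  have hρk : Tendsto (fun j => (ρ j : ℂ) ^ k) (hyperfilter ℕ : Ultrafilter ℕ) (𝓝 0) := by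
    simpa [zero_pow (by omega : k ≠ 0)] using hρ0.pow k
  have hAlim : TendstoLocallyUniformlyOn
      (fun j w => iteratedDeriv k (fun w => H j w ^ n) w - (ρ j : ℂ) ^ k)
      (iteratedDeriv k fun w => G w ^ n) (hyperfilter ℕ : Ultrafilter ℕ) univ := by
    have := hQd.sub (tendstoLocallyUniformlyOn_const hρk univ)
    rwa [show (iteratedDeriv k (fun w => G w ^ n) - fun _ => (0 : ℂ)) =
      iteratedDeriv k fun w => G w ^ n from sub_zero _] at this
  have hBlim : TendstoLocallyUniformlyOn (fun j w => H j w ^ n - 1) (fun w => G w ^ n - 1)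
      (hyperfilter ℕ : Ultrafilter ℕ) univ :=
    hQlim.sub (tendstoLocallyUniformlyOn_const tendsto_const_nhds univ)
  have hiff : ∀ j w, iteratedDeriv k (fun w => H j w ^ n) w - (ρ j : ℂ) ^ k = 0 ↔
      H j w ^ n - 1 = 0 := fun j w => by
    have : (ρ j : ℂ) ^ k ≠ 0 := pow_ne_zero _ (by exact_mod_cast (hρ j).ne')
    rw [sub_eq_zero, sub_eq_zero, hQv, mul_eq_left₀ this, hs]
  have hdk : ∀ {F : ℂ → ℂ}, Differentiable ℂ F → Differentiable ℂ (iteratedDeriv k F) := fun h =>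
    h.contDiff.differentiable_iteratedDeriv k (WithTop.coe_lt_top _)
  by_cases hz : ∃ ζ, G ζ = 0
  · obtain ⟨ζ, hζ⟩ := hz
    by_cases hD : ∃ w, iteratedDeriv k (fun w => G w ^ n) w ≠ 0
    · obtain ⟨w, hw⟩ := hD
      have := eq_zero_of_tendstoLocallyUniformlyOn (fun j => (hdk (hQ j)).sub_const _) (hdk hGn)
        (hGn.sub_const 1).continuous hAlim hBlim (fun j w => (hiff j w).1)
        (iteratedDeriv_pow_eq_zero hG hn hζ) hw
      simp [hζ, hn0] at this
    · push Not at hD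
      refine hGnc 0 fun w => (pow_eq_zero_iff hn0).1
        (eq_zero_of_iteratedDeriv_eq_zero (z₀ := ζ) hGn (fun i => ?_) w)
      rcases lt_or_ge i n with hi | hi
      · exact iteratedDeriv_pow_eq_zero hG hi hζ
      · obtain ⟨d, rfl⟩ := Nat.exists_eq_add_of_le (hn.le.trans hi)
        rw [iteratedDeriv_eq_iterate, add_comm, Function.iterate_add_apply,
          ← iteratedDeriv_eq_iterate, ← iteratedDeriv_eq_iterate, funext hD]
        simp
  · push Not at hz
    obtain ⟨a, b, hab⟩ := exists_eq_exp_affine (C := 1) hG hz fun w => by simpa using hGb w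
    have ha : a ≠ 0 := fun h => hGnc (Complex.exp b) fun w => by rw [hab, h, zero_mul, zero_add]
    have hGe : (fun w => G w ^ n) = fun w => Complex.exp ((n * a) * w + n * b) := by
      funext w
      rw [hab, ← Complex.exp_nat_mul]
      ring_nf
    have h0 : G (-b / a) = 1 := by rw [hab]; field_simp; simp
    have h1 : G ((Real.log 2 - b) / a) = 2 := by
      rw [hab]; field_simp
      simp only [sub_add_cancel]
      rw [← Complex.ofReal_exp, Real.exp_log two_pos]; simp
    have h2 : G ((Real.log 2 - b) / a) ^ n - 1 ≠ 0 := by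
      rw [h1, sub_ne_zero]
      exact_mod_cast (Nat.one_lt_two_pow hn0).ne'
    have := eq_zero_of_tendstoLocallyUniformlyOn (fun j => (hQ j).sub_const 1) (hGn.sub_const 1)
      (hdk hGn).continuous hBlim hAlim (fun j w => (hiff j w).2)
      (z₀ := -b / a) (by simp [h0]) h2
    rw [hGe, iteratedDeriv_cexp_affine] at this
    simp [Complex.exp_ne_zero, ha, hn0] at this

open Metric Set in
theorem norm_iteratedDeriv_le_of_norm_le_exp {F : ℂ → ℂ} (hF : Differentiable ℂ F) {C B : ℝ}
    (hB : 0 ≤ B) (hb : ∀ z, ‖F z‖ ≤ C * Real.exp (B * ‖z‖)) (k : ℕ) (z : ℂ) :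
    ‖iteratedDeriv k F z‖ ≤ k.factorial * (C * Real.exp B) * Real.exp (B * ‖z‖) := by
  have hC : 0 ≤ C := by simpa using (norm_nonneg _).trans (hb 0)
  have := Complex.norm_iteratedDeriv_le_of_forall_mem_sphere_norm_le k (c := z) (f := F)
    (C := C * Real.exp (B * (‖z‖ + 1))) one_pos (hF.diffContOnCl) fun w hw => by
      refine (hb w).trans ?_
      have : ‖w‖ ≤ ‖z‖ + 1 := by
        have := norm_le_norm_sub_add w z
        rw [mem_sphere_iff_norm.1 hw] at this
        linarith
      gcongr
  rw [one_pow, div_one] at this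
  refine this.trans (le_of_eq ?_)
  rw [mul_add, Real.exp_add]
  ring_nf

/-- An entire function `g` such that `g ^ n` and its `k`-th derivative take the value `1` at the
same points, `k < n`, is of exponential type. -/
theorem exists_norm_pow_le_exp_of_share_one {g : ℂ → ℂ} (hg : Differentiable ℂ g)
    (hnc : ¬∃ c, ∀ z, g z = c) {k n : ℕ} (hk : 1 ≤ k) (hn : k < n)
    (hs : ∀ z, iteratedDeriv k (fun w => g w ^ n) z = 1 ↔ g z ^ n = 1) :
    ∃ C B : ℝ, 0 ≤ B ∧ ∀ z, ‖g z ^ n‖ ≤ C * Real.exp (B * ‖z‖) := by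
  obtain ⟨K, hK⟩ := exists_norm_deriv_le_of_share_one hg hk hn hs
  have hz₁ : ∃ z₁, ‖g z₁‖ ≤ 1 := by
    by_contra! h
    have h0 : ∀ z, g z ≠ 0 := fun z hz => by
      have := h z
      rw [hz, norm_zero] at this
      linarith
    obtain ⟨c, hc⟩ := (hg.inv h0).exists_const_forall_eq_of_bounded
      ((Metric.isBounded_closedBall (x := (0 : ℂ)) (r := 1)).subset (by
        rintro _ ⟨z, rfl⟩
        simpa using inv_le_one_of_one_le₀ (h z).le))
    exact hnc ⟨c⁻¹, fun z => by rw [← hc z, Pi.inv_apply, inv_inv]⟩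
  obtain ⟨z₁, hz₁⟩ := hz₁
  refine ⟨Real.exp (n * (2 * max K 0 * ‖z₁‖)), n * (2 * max K 0), by positivity, fun z => ?_⟩
  have := norm_le_exp_of_norm_deriv_le (z := z) hg (le_max_right K 0) hz₁
    fun ζ _ h => (hK ζ h).trans (le_max_left _ _)
  rw [norm_pow, ← Real.exp_add]
  calc ‖g z‖ ^ n ≤ Real.exp (2 * max K 0 * ‖z - z₁‖) ^ n := by gcongr
    _ = Real.exp (n * (2 * max K 0 * ‖z - z₁‖)) := (Real.exp_nat_mul _ _).symm
    _ ≤ _ := by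
      rw [Real.exp_le_exp]
      calc n * (2 * max K 0 * ‖z - z₁‖) ≤ n * (2 * max K 0 * (‖z‖ + ‖z₁‖)) := by
            gcongr; exact norm_sub_le _ _
        _ = _ := by ring

open ValueDistribution Real in
theorem characteristic_top_le_of_norm_le_exp {P : ℂ → ℂ} (hP : Differentiable ℂ P) {C B r : ℝ}
    (hC : 1 ≤ C) (hB : 0 ≤ B) (hb : ∀ z, ‖P z‖ ≤ C * Real.exp (B * ‖z‖)) (hr : 0 ≤ r) :
    characteristic P ⊤ r ≤ Real.log C + B * r := by
  have h1 : logCounting P ⊤ = 0 := by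
    have : AnalyticOnNhd ℂ P Set.univ := fun z _ => hP.analyticAt z
    have h0 := MeromorphicOn.AnalyticOnNhd.divisor_nonneg this
    rw [logCounting_top, negPart_eq_zero.2 h0, map_zero]
  have hm : Meromorphic P := fun z => (hP.analyticAt z).meromorphicAt
  rw [characteristic, h1, add_zero, proximity_top]
  refine circleAverage_mono_on_of_le_circle hm.meromorphicOn.circleIntegrable_posLog_norm ?_
  intro z hz
  have hz' : ‖z‖ = r := by simpa [abs_of_nonneg hr] using hz
  rw [posLog_apply]
  refine max_le (add_nonneg (log_nonneg hC) (by positivity)) ?_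
  rcases eq_or_ne (P z) 0 with h | h
  · rw [h, norm_zero, log_zero]
    exact add_nonneg (log_nonneg hC) (by positivity)
  · refine (log_le_log (norm_pos_iff.2 h) (hb z)).trans ?_
    rw [log_mul (by positivity) (by positivity), log_exp, hz']

open ValueDistribution Real Metric Filter Topology in
/-- A zero-free entire quotient of two functions of exponential type is the exponential of an
affine function. -/
theorem exists_eq_exp_affine_of_mul_eq {P Q φ : ℂ → ℂ} (hP : Differentiable ℂ P)
    (hQ : Differentiable ℂ Q) (hφ : Differentiable ℂ φ) (hφ0 : ∀ z, φ z ≠ 0)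
    (h : ∀ z, P z = φ z * Q z) {z₀ : ℂ} (hz₀ : Q z₀ ≠ 0) {C B : ℝ} (hC : 1 ≤ C) (hB : 0 ≤ B)
    (hPb : ∀ z, ‖P z‖ ≤ C * Real.exp (B * ‖z‖)) (hQb : ∀ z, ‖Q z‖ ≤ C * Real.exp (B * ‖z‖)) :
    ∃ a b, ∀ z, φ z = Complex.exp (a * z + b) := by
  obtain ⟨α, hα, hαφ⟩ := exists_eq_exp hφ hφ0
  have hlog : ∀ z, Real.log ‖φ z‖ = (α z).re := fun z => by
    rw [hαφ, Complex.norm_exp, log_exp]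
  have hQa : AnalyticOnNhd ℂ Q Set.univ := fun z _ => hQ.analyticAt z
  have hmP : Meromorphic P := fun z => (hP.analyticAt z).meromorphicAt
  have hmQ : Meromorphic Q := fun z => (hQ.analyticAt z).meromorphicAt
  have hmφ : Meromorphic φ := fun z => (hφ.analyticAt z).meromorphicAt
  have hQ0 : ∀ᶠ z in codiscrete ℂ, Q z ≠ 0 := by
    simpa using! hQa.preimage_zero_mem_codiscrete hz₀
  have hord : ∀ {f : ℂ → ℂ}, (∀ᶠ z in codiscrete ℂ, f z ≠ 0) → ∀ z, meromorphicOrderAt f z ≠ ⊤ := by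
    intro f hf z hz
    have h1 := meromorphicOrderAt_eq_top_iff.1 hz
    have h2 : ∀ᶠ w in 𝓝[≠] z, f w ≠ 0 := by
      have := disjoint_principal_right.1 (mem_codiscrete.1 hf z)
      rwa [compl_compl] at this
    obtain ⟨w, hw1, hw2⟩ := (h1.and h2).exists
    exact hw2 hw1
  have hP0 : ∀ᶠ z in codiscrete ℂ, P z ≠ 0 := by
    filter_upwards [hQ0] with z hz
    rw [h]
    exact mul_ne_zero (hφ0 z) hz
  set T := |Real.log ‖meromorphicTrailingCoeffAt Q 0‖| with hT
  have hchar : ∀ r, 1 ≤ r → proximity φ ⊤ r ≤ 2 * Real.log C + T + 2 * B * r := by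
    intro r hr
    have h1 : characteristic φ ⊤ r = characteristic (P * Q⁻¹) ⊤ r := by
      refine characteristic_congr_codiscrete ?_ (by positivity)
      filter_upwards [hQ0] with z hz
      rw [Pi.mul_apply, Pi.inv_apply, h, mul_inv_cancel_right₀ hz]
    have h2 := characteristic_mul_top_le hr hmP (hord hP0) hmQ.inv
      (hord (f := Q⁻¹) (by filter_upwards [hQ0] with z hz using inv_ne_zero hz))
    have h3 := characteristic_sub_characteristic_inv_of_ne_zero hmQ (R := r) (by positivity)
    have h4 := characteristic_top_le_of_norm_le_exp hP hC hB hPb (r := r) (by positivity)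
    have h5 := characteristic_top_le_of_norm_le_exp hQ hC hB hQb (r := r) (by positivity)
    have h6 : proximity φ ⊤ r ≤ characteristic φ ⊤ r :=
      le_add_of_nonneg_right (logCounting_nonneg hr)
    have h7 := neg_abs_le (Real.log ‖meromorphicTrailingCoeffAt Q 0‖)
    rw [Pi.add_apply] at h2
    linarith
  have hharm : ∀ r, InnerProductSpace.HarmonicOnNhd (fun z => (α z).re) (closedBall 0 r) :=
    fun r z _ => (hα.analyticAt z).harmonicAt_re
  have hcont : Continuous fun z => (α z).re := Complex.continuous_re.comp hα.continuous
  have havg : ∀ r, circleAverage (fun z => |(α z).re|) 0 r = 2 * proximity φ ⊤ r - (α 0).re := by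
    intro r
    rw [← InnerProductSpace.HarmonicOnNhd.circleAverage_eq (hharm |r|), proximity_top,
      ← smul_eq_mul, ← circleAverage_fun_smul, ← circleAverage_fun_sub]
    · congr 1
      funext z
      rw [← half_mul_log_add_log_abs, hlog, smul_eq_mul]
      ring
    · exact hmφ.meromorphicOn.circleIntegrable_posLog_norm.const_smul
    · exact hcont.continuousOn.circleIntegrable'
  obtain ⟨a, b, hab⟩ := exists_affine_of_re_le (A := 3 * (4 * Real.log C + 2 * T + 4 * B + |(α 0).re|))
    (B := 24 * B) hα fun z => by
      have hr : (1 : ℝ) ≤ 2 * ‖z‖ + 1 := by linarith [norm_nonneg z]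
      have h1 := harmonic_le_circleAverage_abs (u := fun z => (α z).re) (c := 0) (w := z)
        (R := 2 * ‖z‖ + 1) ⟨(hharm _).mono ball_subset_closedBall, hcont.continuousOn⟩
        (by rw [mem_ball_zero_iff]; linarith [norm_nonneg z])
      rw [havg, sub_zero] at h1
      have h2 := hchar _ hr
      have h3 : (2 * ‖z‖ + 1 + ‖z‖) / (2 * ‖z‖ + 1 - ‖z‖) ≤ 3 := by
        rw [div_le_iff₀ (by linarith [norm_nonneg z])]
        linarith
      have h4 := neg_abs_le (α 0).re
      have hX : 0 ≤ 4 * Real.log C + 2 * T + 4 * B * (2 * ‖z‖ + 1) + |(α 0).re| := by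
        have := log_nonneg hC
        positivity
      refine h1.trans ((mul_le_mul_of_nonneg_left (b := 2 * proximity φ ⊤ (2 * ‖z‖ + 1) - (α 0).re)
        (c := 4 * Real.log C + 2 * T + 4 * B * (2 * ‖z‖ + 1) + |(α 0).re|) (by linarith) ?_).trans
        ((mul_le_mul_of_nonneg_right h3 hX).trans (by linarith)))
      exact div_nonneg (by positivity) (by linarith [norm_nonneg z])
  exact ⟨a, b, fun z => by rw [hαφ, hab]⟩

open Metric Set Asymptotics in
/-- An entire function of exponential type that is bounded on both axes is bounded. -/
theorem norm_le_of_norm_le_exp_of_axes {W : ℂ → ℂ} (hW : Differentiable ℂ W) {C B M : ℝ}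
    (hb : ∀ z, ‖W z‖ ≤ C * Real.exp (B * ‖z‖)) (hre : ∀ x : ℝ, ‖W x‖ ≤ M)
    (him : ∀ x : ℝ, ‖W (x * Complex.I)‖ ≤ M) (z : ℂ) : ‖W z‖ ≤ M := by
  have hO : ∀ l : Filter ℂ, ∃ c < (2 : ℝ), ∃ B, W =O[l] fun z => Real.exp (B * ‖z‖ ^ c) :=
    fun l => ⟨1, by norm_num, B, IsBigO.of_bound C (.of_forall fun z => by
      simpa [abs_of_pos (Real.exp_pos _)] using hb z)⟩
  rcases le_total 0 z.re with h1 | h1 <;> rcases le_total 0 z.im with h2 | h2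
  · exact PhragmenLindelof.quadrant_I hW.diffContOnCl (hO _) (fun x _ => hre x) (fun x _ => him x)
      h1 h2
  · exact PhragmenLindelof.quadrant_IV hW.diffContOnCl (hO _) (fun x _ => hre x) (fun x _ => him x)
      h1 h2
  · exact PhragmenLindelof.quadrant_II hW.diffContOnCl (hO _) (fun x _ => hre x) (fun x _ => him x)
      h1 h2
  · exact PhragmenLindelof.quadrant_III hW.diffContOnCl (hO _) (fun x _ => hre x)
      (fun x _ => him x) h1 h2

/-- Along a ray, an exponential bound of rate at least `1` on the derivative of an entire function
passes to the function. -/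
theorem exists_norm_le_exp_of_norm_deriv_le {h : ℂ → ℂ} (hh : Differentiable ℂ h) (w : ℂ)
    {C β : ℝ} (hβ : 1 ≤ β) (hb : ∀ t : ℝ, 0 ≤ t → ‖deriv h (t * w)‖ ≤ C * Real.exp (β * t)) :
    ∃ C', ∀ t : ℝ, 0 ≤ t → ‖h (t * w)‖ ≤ C' * Real.exp (β * t) := by
  have hC : 0 ≤ C := by simpa using (norm_nonneg _).trans (hb 0 le_rfl)
  refine ⟨‖h 0‖ + C * ‖w‖, fun t ht => ?_⟩
  have hd : ∀ x : ℝ, HasDerivAt (fun x : ℝ => h (x * w)) (deriv h (x * w) * w) x := fun x => by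
    have h1 : HasDerivAt (fun x : ℝ => (x : ℂ) * w) w x := by
      simpa using (Complex.ofRealCLM.hasDerivAt (x := x)).mul_const w
    exact (hh _).hasDerivAt.comp x h1
  have hB : ∀ x : ℝ, HasDerivAt (fun x => ‖h 0‖ + C * ‖w‖ * Real.exp (β * x))
      (C * ‖w‖ * (Real.exp (β * x) * β)) x := fun x => by
    have h1 : HasDerivAt (fun x : ℝ => β * x) β x := by simpa using (hasDerivAt_id x).const_mul β
    exact (h1.exp.const_mul _).const_add _
  have := image_norm_le_of_norm_deriv_right_le_deriv_boundary (a := 0) (b := t)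
    (fun x _ => (hd x).continuousAt.continuousWithinAt) (fun x _ => (hd x).hasDerivWithinAt)
    (by simpa using mul_nonneg hC (norm_nonneg w)) hB (fun x hx => by
      rw [norm_mul]
      calc ‖deriv h (x * w)‖ * ‖w‖ ≤ C * Real.exp (β * x) * ‖w‖ := by
            gcongr; exact hb x hx.1
        _ = C * ‖w‖ * (Real.exp (β * x) * 1) := by ring
        _ ≤ _ := by gcongr) (Set.right_mem_Icc.2 ht)
  refine this.trans ?_
  have h1 : 1 ≤ Real.exp (β * t) := Real.one_le_exp (by positivity)
  nlinarith [norm_nonneg (h 0)]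

theorem exists_norm_le_exp_of_norm_iteratedDeriv_le {h : ℂ → ℂ} (hh : Differentiable ℂ h) (w : ℂ)
    {C β : ℝ} (hβ : 1 ≤ β) (k : ℕ)
    (hb : ∀ t : ℝ, 0 ≤ t → ‖iteratedDeriv k h (t * w)‖ ≤ C * Real.exp (β * t)) :
    ∃ C', ∀ t : ℝ, 0 ≤ t → ‖h (t * w)‖ ≤ C' * Real.exp (β * t) := by
  induction k generalizing C with
  | zero => exact ⟨C, by simpa using hb⟩
  | succ k ih =>
    simp only [iteratedDeriv_succ] at hb
    obtain ⟨C', hC'⟩ := exists_norm_le_exp_of_norm_deriv_le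
      (hh.contDiff.differentiable_iteratedDeriv k (WithTop.coe_lt_top _)) w hβ hb
    exact ih hC'

section ExponentialTwist

variable {F : ℂ → ℂ} {C B : ℝ} {A : ℂ} {k : ℕ}

theorem exists_norm_sub_one_le_of_re_ge (hF : Differentiable ℂ F) (hB : 0 ≤ B)
    (hb : ∀ z, ‖F z‖ ≤ C * Real.exp (B * ‖z‖)) (hk : 1 ≤ k)
    (h : ∀ s, A * iteratedDeriv k F s - 1 = Complex.exp s * (F s - 1)) (N : ℕ) :
    ∃ M : ℝ, 0 ≤ M ∧
      (∀ s : ℂ, (N : ℝ) ≤ s.re →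
        ‖F s - 1‖ ≤ M * (Real.exp (B * ‖s‖ - N * s.re) + Real.exp (-s.re))) ∧
      ∀ s : ℂ, (N : ℝ) + 1 ≤ s.re →
        ‖iteratedDeriv k F s‖ ≤ M * (Real.exp (B * ‖s‖ - N * s.re) + Real.exp (-s.re)) := by
  have hC : 0 ≤ C := by simpa using (norm_nonneg _).trans (hb 0)
  have hcauchy : ∀ (N : ℕ) (M : ℝ), 0 ≤ M → (∀ s : ℂ, (N : ℝ) ≤ s.re →
      ‖F s - 1‖ ≤ M * (Real.exp (B * ‖s‖ - N * s.re) + Real.exp (-s.re))) →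
      ∀ s : ℂ, (N : ℝ) + 1 ≤ s.re → ‖iteratedDeriv k F s‖ ≤
        k.factorial * (M * Real.exp (B + N + 1)) *
          (Real.exp (B * ‖s‖ - N * s.re) + Real.exp (-s.re)) := by
    intro N M hM hbd s hs
    have h1 : iteratedDeriv k F s = iteratedDeriv k (fun z => -1 + F z) s :=
      (iteratedDeriv_const_add hk (-1)).symm
    rw [h1]
    have := Complex.norm_iteratedDeriv_le_of_forall_mem_sphere_norm_le k (c := s)
      (f := fun z => -1 + F z) (C := M * Real.exp (B + N + 1) *
          (Real.exp (B * ‖s‖ - N * s.re) + Real.exp (-s.re))) one_pos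
      ((hF.const_add _).diffContOnCl) fun w hw => by
        rw [mem_sphere_iff_norm] at hw
        have h2 : |w.re - s.re| ≤ 1 := by
          rw [← Complex.sub_re, ← hw]; exact Complex.abs_re_le_norm _
        have h3 := (abs_le.1 h2).1
        have h4 : ‖w‖ ≤ ‖s‖ + 1 := by
          have := norm_le_norm_sub_add w s
          linarith
        have h5 : (N : ℝ) ≤ w.re := by linarith
        rw [neg_add_eq_sub]
        refine (hbd w h5).trans ?_
        rw [mul_assoc, mul_add (Real.exp _), ← Real.exp_add, ← Real.exp_add]
        have hN : (0 : ℝ) ≤ N := N.cast_nonneg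
        have h6 : B * ‖w‖ ≤ B * (‖s‖ + 1) := mul_le_mul_of_nonneg_left h4 hB
        have h7 : (N : ℝ) * (s.re - 1) ≤ N * w.re := mul_le_mul_of_nonneg_left (by linarith) hN
        gcongr
        · linarith
        · linarith
    rw [one_pow, div_one] at this
    exact this.trans (le_of_eq (by ring))
  have key : ∃ M : ℝ, 0 ≤ M ∧ ∀ s : ℂ, (N : ℝ) ≤ s.re →
        ‖F s - 1‖ ≤ M * (Real.exp (B * ‖s‖ - N * s.re) + Real.exp (-s.re)) := by
    induction N with
    | zero =>
      refine ⟨C + 1, by positivity, fun s _ => ?_⟩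
      have h1 : 1 ≤ Real.exp (B * ‖s‖) := Real.one_le_exp (by positivity)
      calc ‖F s - 1‖ ≤ ‖F s‖ + 1 := by simpa using norm_sub_le (F s) 1
        _ ≤ C * Real.exp (B * ‖s‖) + Real.exp (B * ‖s‖) := add_le_add (hb s) h1
        _ = (C + 1) * (Real.exp (B * ‖s‖) + 0) := by ring
        _ ≤ _ := by
          have := Real.exp_pos (-s.re)
          simp only [Nat.cast_zero, zero_mul, sub_zero]
          gcongr
    | succ N ih =>
      obtain ⟨M, hM, hbd⟩ := ih
      have hN : (0 : ℝ) ≤ N := N.cast_nonneg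
      set M' := k.factorial * (M * Real.exp (B + N + 1)) with hM'
      have hM'0 : 0 ≤ M' := by positivity
      refine ⟨‖A‖ * M' + 1, by positivity, fun s hs => ?_⟩
      push_cast at hs ⊢
      have h1 := hcauchy N M hM hbd s hs
      have h2 : F s - 1 = Complex.exp (-s) * (A * iteratedDeriv k F s - 1) := by
        rw [h, ← mul_assoc, ← Complex.exp_add, neg_add_cancel, Complex.exp_zero, one_mul]
      have h3 : ‖Complex.exp (-s)‖ = Real.exp (-s.re) := by simp [Complex.norm_exp]
      have h4 : Real.exp (-s.re) ≤ 1 := Real.exp_le_one_iff.2 (by linarith)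
      have h5 : Real.exp (-s.re) * Real.exp (B * ‖s‖ - N * s.re) =
          Real.exp (B * ‖s‖ - (N + 1) * s.re) := by
        rw [← Real.exp_add]; ring_nf
      have h6 := Real.exp_pos (-s.re)
      have h7 := Real.exp_pos (B * ‖s‖ - (N + 1) * s.re)
      rw [h2, norm_mul, h3]
      calc Real.exp (-s.re) * ‖A * iteratedDeriv k F s - 1‖
          ≤ Real.exp (-s.re) * (‖A‖ * (M' * (Real.exp (B * ‖s‖ - N * s.re) + Real.exp (-s.re)))
              + 1) := by
            gcongr
            refine (norm_sub_le _ _).trans ?_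
            rw [norm_mul, norm_one]
            gcongr
        _ = ‖A‖ * M' * (Real.exp (B * ‖s‖ - (N + 1) * s.re) + Real.exp (-s.re) * Real.exp (-s.re))
              + Real.exp (-s.re) := by rw [← h5]; ring
        _ ≤ ‖A‖ * M' * (Real.exp (B * ‖s‖ - (N + 1) * s.re) + Real.exp (-s.re) * 1)
              + (Real.exp (B * ‖s‖ - (N + 1) * s.re) + Real.exp (-s.re)) := by
            gcongr
            linarith
        _ = _ := by ring
  obtain ⟨M, hM, hbd⟩ := key
  refine ⟨M + k.factorial * (M * Real.exp (B + N + 1)), by positivity,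
    fun s hs => (hbd s hs).trans ?_, fun s hs => (hcauchy N M hM hbd s hs).trans ?_⟩
  · gcongr
    exact le_add_of_nonneg_right (by positivity)
  · gcongr
    exact le_add_of_nonneg_left (by positivity)

theorem exists_norm_iteratedDeriv_le_of_re_eq_neg_one (hF : Differentiable ℂ F) (hB : 0 ≤ B)
    (hb : ∀ z, ‖F z‖ ≤ C * Real.exp (B * ‖z‖)) (hA : A ≠ 0)
    (h : ∀ s, A * iteratedDeriv k F s - 1 = Complex.exp s * (F s - 1)) {w : ℂ} (hw : w.re = -1)
    (hw2 : ‖w‖ ≤ 2) : ∃ M : ℝ, ∀ t : ℝ, 0 ≤ t → ‖iteratedDeriv k F (t * w)‖ ≤ M := by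
  have hC : 0 ≤ C := by simpa using (norm_nonneg _).trans (hb 0)
  have hV : ∀ (M β : ℝ), 1 ≤ β → (∀ t : ℝ, 0 ≤ t → ‖F (t * w)‖ ≤ M * Real.exp (β * t)) →
      ∀ t : ℝ, 0 ≤ t → ‖iteratedDeriv k F (t * w)‖ ≤ ‖A‖⁻¹ * (M + 2) * Real.exp ((β - 1) * t) := by
    intro M β hβ hM t ht
    have h1 : iteratedDeriv k F (t * w) = A⁻¹ * (Complex.exp (t * w) * (F (t * w) - 1) + 1) := by
      rw [← h, sub_add_cancel, inv_mul_cancel_left₀ hA]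
    have h2 : ‖Complex.exp (t * w)‖ = Real.exp (-t) := by simp [Complex.norm_exp, hw]
    have h3 : 1 ≤ Real.exp ((β - 1) * t) := Real.one_le_exp (mul_nonneg (by linarith) ht)
    have h4 : Real.exp (-t) ≤ 1 := Real.exp_le_one_iff.2 (by linarith)
    have h5 : Real.exp (-t) * Real.exp (β * t) = Real.exp ((β - 1) * t) := by
      rw [← Real.exp_add]; ring_nf
    rw [h1, norm_mul, norm_inv, mul_assoc]
    gcongr
    calc ‖Complex.exp (t * w) * (F (t * w) - 1) + 1‖
        ≤ Real.exp (-t) * (M * Real.exp (β * t) + 1) + 1 := by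
          refine (norm_add_le _ _).trans ?_
          rw [norm_mul, h2, norm_one]
          gcongr
          refine (norm_sub_le _ _).trans ?_
          rw [norm_one]
          gcongr
          exact hM t ht
      _ = M * Real.exp ((β - 1) * t) + Real.exp (-t) + 1 := by rw [← h5]; ring
      _ ≤ _ := by linarith
  have hstep : ∀ j : ℕ, (∃ M, ∀ t : ℝ, 0 ≤ t → ‖F (t * w)‖ ≤ M * Real.exp ((j + 1 : ℕ) * t)) →
      ∃ M, ∀ t : ℝ, 0 ≤ t → ‖F (t * w)‖ ≤ M * Real.exp (((1 : ℕ) : ℝ) * t) := by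
    intro j
    induction j with
    | zero => exact fun h => by simpa using h
    | succ j ih =>
      rintro ⟨M, hM⟩
      have h1 := hV M _ (by push_cast; linarith [(Nat.cast_nonneg j : (0 : ℝ) ≤ j)]) hM
      obtain ⟨M', hM'⟩ := exists_norm_le_exp_of_norm_iteratedDeriv_le hF w
        (by push_cast; linarith [(Nat.cast_nonneg j : (0 : ℝ) ≤ j)]) k h1
      refine ih ⟨M', fun t ht => (hM' t ht).trans_eq ?_⟩
      push_cast
      ring_nf
  obtain ⟨j, hj⟩ := exists_nat_ge (2 * B)
  obtain ⟨M, hM⟩ := hstep j ⟨C, fun t ht => (hb _).trans (by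
    have : B * ‖t * w‖ ≤ (j + 1 : ℕ) * t := by
      rw [norm_mul, Complex.norm_real, Real.norm_of_nonneg ht]
      calc B * (t * ‖w‖) ≤ B * (t * 2) := by gcongr
        _ = (2 * B) * t := by ring
        _ ≤ _ := by gcongr; push_cast; linarith
    gcongr)⟩
  refine ⟨‖A‖⁻¹ * (M + 2), fun t ht => ?_⟩
  simpa using hV M _ (by simp) hM t ht

open Filter Topology in
/-- The equation `A F⁽ᵏ⁾ - 1 = eˢ (F - 1)` has no solution of exponential type. -/
theorem not_forall_mul_iteratedDeriv_sub_one_eq (hF : Differentiable ℂ F) (hB : 0 ≤ B)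
    (hb : ∀ z, ‖F z‖ ≤ C * Real.exp (B * ‖z‖)) (hk : 1 ≤ k) (hA : A ≠ 0) :
    ¬∀ s, A * iteratedDeriv k F s - 1 = Complex.exp s * (F s - 1) := by
  intro h
  have hC : 0 ≤ C := by simpa using (norm_nonneg _).trans (hb 0)
  have hdF : Differentiable ℂ (iteratedDeriv k F) :=
    hF.contDiff.differentiable_iteratedDeriv k (WithTop.coe_lt_top _)
  have hVb := norm_iteratedDeriv_le_of_norm_le_exp hF hB hb k
  set C' := k.factorial * (C * Real.exp B) with hC'
  have hC'0 : 0 ≤ C' := by positivity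
  obtain ⟨N, hN⟩ := exists_nat_ge (2 * B + 1)
  obtain ⟨M, hM, -, hMb⟩ := exists_norm_sub_one_le_of_re_ge hF hB hb hk h N
  have hright : ∀ w : ℂ, w.re = 1 → ‖w‖ ≤ 2 → ∀ t : ℝ, N + 1 ≤ t →
      ‖iteratedDeriv k F (t * w)‖ ≤ 2 * M * Real.exp (-t) := by
    intro w hw hw2 t ht
    have hre : (t * w).re = t := by simp [hw]
    have ht0 : 0 ≤ t := (by positivity : (0 : ℝ) ≤ N + 1).trans ht
    refine (hMb _ (by rwa [hre])).trans ?_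
    rw [hre, norm_mul, Complex.norm_real, Real.norm_of_nonneg ht0]
    have : B * (t * ‖w‖) - N * t ≤ -t := by
      have h1 : B * (t * ‖w‖) ≤ B * (t * 2) := by gcongr
      have h2 : (2 * B + 1) * t ≤ N * t := by gcongr
      linarith
    have := Real.exp_le_exp.2 this
    nlinarith
  have hright' : ∀ w : ℂ, w.re = 1 → ‖w‖ ≤ 2 → ∀ t : ℝ, 0 ≤ t →
      ‖iteratedDeriv k F (t * w)‖ ≤ 2 * M + C' * Real.exp (B * ((N + 1) * 2)) := by
    intro w hw hw2 t ht
    rcases le_total ((N : ℝ) + 1) t with h1 | h1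
    · refine (hright w hw hw2 t h1).trans ?_
      have : Real.exp (-t) ≤ 1 := Real.exp_le_one_iff.2 (by linarith)
      have h3 : 0 ≤ C' * Real.exp (B * ((N + 1) * 2)) := by positivity
      nlinarith
    · refine (hVb _).trans ?_
      rw [norm_mul, Complex.norm_real, Real.norm_of_nonneg ht]
      have : C' * Real.exp (B * (t * ‖w‖)) ≤ C' * Real.exp (B * ((N + 1) * 2)) := by gcongr
      linarith
  have hnorm : ∀ w : ℂ, |w.re| = 1 → |w.im| = 1 → ‖w‖ ≤ 2 := fun w h1 h2 =>
    (Complex.norm_le_abs_re_add_abs_im w).trans (by rw [h1, h2]; norm_num)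
  obtain ⟨M₁, hM₁⟩ := exists_norm_iteratedDeriv_le_of_re_eq_neg_one hF hB hb hA h
    (w := -1 + Complex.I) (by simp) (hnorm _ (by simp) (by simp))
  obtain ⟨M₂, hM₂⟩ := exists_norm_iteratedDeriv_le_of_re_eq_neg_one hF hB hb hA h
    (w := -1 - Complex.I) (by simp) (hnorm _ (by simp) (by simp))
  have hr₁ := hright' (1 + Complex.I) (by simp) (hnorm _ (by simp) (by simp))
  have hr₂ := hright' (1 - Complex.I) (by simp) (hnorm _ (by simp) (by simp))
  set M₀ := 2 * M + C' * Real.exp (B * ((N + 1) * 2)) with hM₀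
  have hI : (1 + Complex.I) ≠ 0 := fun h => by simpa using congrArg Complex.re h
  have hW := norm_le_of_norm_le_exp_of_axes (W := fun s => iteratedDeriv k F (s * (1 + Complex.I)))
    (C := C') (B := B * 2) (M := max M₀ (max M₁ M₂)) (hdF.comp (by fun_prop)) (fun z => by
      refine (hVb _).trans ?_
      rw [norm_mul, mul_assoc B, mul_comm 2]
      have := hnorm (1 + Complex.I) (by simp) (by simp)
      gcongr) (fun x => by
      rcases le_total 0 x with hx | hx
      · exact (hr₁ x hx).trans (le_max_left _ _)
      · have := hM₂ (-x) (by linarith)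
        rw [show ((-x : ℝ) : ℂ) * (-1 - Complex.I) = x * (1 + Complex.I) by push_cast; ring] at this
        exact this.trans ((le_max_right _ _).trans (le_max_right _ _))) (fun x => by
      have hII : x * Complex.I * (1 + Complex.I) = x * (-1 + Complex.I) := by
        rw [mul_assoc, mul_add, Complex.I_mul_I]; ring
      rw [hII]
      rcases le_total 0 x with hx | hx
      · exact (hM₁ x hx).trans ((le_max_left _ _).trans (le_max_right _ _))
      · have := hr₂ (-x) (by linarith)
        rw [show ((-x : ℝ) : ℂ) * (1 - Complex.I) = x * (-1 + Complex.I) by push_cast; ring] at this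
        exact this.trans (le_max_left _ _))
  obtain ⟨v, hv⟩ := hdF.exists_const_forall_eq_of_bounded
    ((Metric.isBounded_closedBall (x := (0 : ℂ)) (r := max M₀ (max M₁ M₂))).subset (by
      rintro _ ⟨z, rfl⟩
      have := hW (z / (1 + Complex.I))
      rw [div_mul_cancel₀ _ hI] at this
      simpa using this))
  have hv0 : v = 0 := by
    rw [← norm_le_zero_iff]
    have h1 : Tendsto (fun t : ℝ => 2 * M * Real.exp (-t)) atTop (𝓝 0) := by
      simpa using Real.tendsto_exp_neg_atTop_nhds_zero.const_mul (2 * M)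
    refine ge_of_tendsto h1 ((eventually_ge_atTop ((N : ℝ) + 1)).mono fun t ht => ?_)
    have := hright 1 (by simp) (by simp) t ht
    rwa [hv] at this
  subst hv0
  have hFe : (fun s => -1 + F s) = fun s => -Complex.exp (-1 * s + 0) := by
    funext s
    have h1 := h s
    rw [hv, mul_zero, zero_sub] at h1
    rw [neg_one_mul, add_zero, Complex.exp_neg, neg_add_eq_sub]
    exact (eq_neg_of_add_eq_zero_left <| (mul_eq_zero_iff_left (Complex.exp_ne_zero s)).1 <| by
      rw [mul_add, ← h1, mul_inv_cancel₀ (Complex.exp_ne_zero s), neg_add_cancel])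
  have h1 : iteratedDeriv k (fun s => -1 + F s) 0 = 0 := by
    rw [iteratedDeriv_const_add hk, hv]
  rw [hFe, iteratedDeriv_fun_neg, iteratedDeriv_cexp_affine] at h1
  simp at h1

end ExponentialTwist

/-- The ratio in the sharing relation between `g ^ n` and its `k`-th derivative is constant. -/
theorem exists_iteratedDeriv_pow_sub_one_eq_const_mul {g : ℂ → ℂ} (hg : Differentiable ℂ g)
    {k n : ℕ} (hk : 1 ≤ k) {C B : ℝ} (hB : 0 ≤ B)
    (hb : ∀ z, ‖g z ^ n‖ ≤ C * Real.exp (B * ‖z‖)) {φ : ℂ → ℂ} (hφ : Differentiable ℂ φ)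
    (hφ0 : ∀ z, φ z ≠ 0)
    (h : ∀ z, iteratedDeriv k (fun w => g w ^ n) z - 1 = φ z * (g z ^ n - 1)) :
    ∃ c : ℂ, ∀ z, iteratedDeriv k (fun w => g w ^ n) z - 1 = c * (g z ^ n - 1) := by
  have hF : Differentiable ℂ fun w => g w ^ n := hg.pow n
  have hC : 0 ≤ C := by simpa using (norm_nonneg _).trans (hb 0)
  have hdF : Differentiable ℂ (iteratedDeriv k fun w => g w ^ n) :=
    hF.contDiff.differentiable_iteratedDeriv k (WithTop.coe_lt_top _)
  have hz₀ : ∃ z₀, g z₀ ^ n - 1 ≠ 0 := by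
    by_contra! h1
    have h2 : (fun w => g w ^ n) = fun _ => 1 := funext fun z => sub_eq_zero.1 (h1 z)
    have h3 := h 0
    rw [h1, mul_zero, h2, iteratedDeriv_const, if_neg (by omega)] at h3
    simp at h3
  obtain ⟨z₀, hz₀⟩ := hz₀
  have hVb := norm_iteratedDeriv_le_of_norm_le_exp hF hB hb k
  set C' := k.factorial * (C * Real.exp B) with hC'
  have hC'0 : 0 ≤ C' := by positivity
  have h1 : ∀ z : ℂ, 1 ≤ Real.exp (B * ‖z‖) := fun z => Real.one_le_exp (by positivity)
  obtain ⟨a, b, hab⟩ := exists_eq_exp_affine_of_mul_eq (hdF.sub_const 1) (hF.sub_const 1) hφ hφ0 h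
    hz₀ (C := C + C' + 1) (B := B) (by linarith) hB
    (fun z => by
      refine (norm_sub_le _ _).trans ?_
      rw [norm_one]
      nlinarith [hVb z, h1 z]) (fun z => by
      refine (norm_sub_le _ _).trans ?_
      rw [norm_one]
      nlinarith [hb z, h1 z])
  rcases eq_or_ne a 0 with ha | ha
  · exact ⟨Complex.exp b, fun z => by rw [h, hab, ha, zero_mul, zero_add]⟩
  · refine absurd ?_ (not_forall_mul_iteratedDeriv_sub_one_eq (A := a ^ k)
      (F := fun s => g (-b / a + a⁻¹ * s) ^ n) (C := C * Real.exp (B * ‖-b / a‖))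
      (B := B * ‖a⁻¹‖) (hF.comp (by fun_prop)) (by positivity) (fun s => ?_) hk (pow_ne_zero k ha))
    · intro s
      rw [iteratedDeriv_comp_affine hF, ← mul_assoc, ← mul_pow, mul_inv_cancel₀ ha, one_pow,
        one_mul, h, hab]
      congr 2
      field_simp
      ring
    · refine (hb _).trans ?_
      rw [mul_assoc, ← Real.exp_add]
      have : B * ‖-b / a + a⁻¹ * s‖ ≤ B * (‖-b / a‖ + ‖a⁻¹‖ * ‖s‖) := by
        gcongr
        exact (norm_add_le _ _).trans_eq (by rw [norm_mul])
      gcongr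
      linarith

/-- The one-variable case: if `g ^ n` and its `k`-th derivative share the value `1` CM, `k < n`,
then `g` is an exponential. -/
theorem exists_eq_mul_deriv_of_share_one {g : ℂ → ℂ} (hg : Differentiable ℂ g)
    (hnc : ¬∃ c, ∀ z, g z = c) {k n : ℕ} (hk : 1 ≤ k) (hn : k < n) {φ : ℂ → ℂ}
    (hφ : Differentiable ℂ φ) (hφ0 : ∀ z, φ z ≠ 0)
    (h : ∀ z, iteratedDeriv k (fun w => g w ^ n) z - 1 = φ z * (g z ^ n - 1)) :
    ∃ c : ℂ, c ≠ 0 ∧ (c / n) ^ k = 1 ∧ ∀ z, g z = c * deriv g z := by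
  have hn0 : n ≠ 0 := by omega
  have hnC : (n : ℂ) ≠ 0 := Nat.cast_ne_zero.2 hn0
  have hF : Differentiable ℂ fun w => g w ^ n := hg.pow n
  obtain ⟨C, B, hB, hb⟩ := exists_norm_pow_le_exp_of_share_one hg hnc hk hn fun z => by
    rw [← sub_eq_zero, h, mul_eq_zero_iff_left (hφ0 z), sub_eq_zero]
  obtain ⟨c, hc⟩ := exists_iteratedDeriv_pow_sub_one_eq_const_mul hg hk hB hb hφ hφ0 h
  have hg0 : ∀ z, g z ≠ 0 := by
    intro z₀ hz₀
    have h1 := hc z₀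
    rw [iteratedDeriv_pow_eq_zero hg hn hz₀, hz₀, zero_pow hn0] at h1
    have hc1 : c = 1 := by linear_combination h1
    have h2 : iteratedDeriv k (fun w => g w ^ n) = fun w => g w ^ n :=
      funext fun z => by simpa [hc1] using hc z
    refine hnc ⟨0, fun z => (pow_eq_zero_iff hn0).1
      (eq_zero_of_iteratedDeriv_eq_zero (z₀ := z₀) hF (fun i => ?_) z)⟩
    induction i using Nat.strong_induction_on with
    | _ i ih =>
      rcases lt_or_ge i n with hi | hi
      · exact iteratedDeriv_pow_eq_zero hg hi hz₀
      · obtain ⟨d, rfl⟩ := Nat.exists_eq_add_of_le (hn.le.trans hi)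
        rw [iteratedDeriv_eq_iterate, add_comm, Function.iterate_add_apply,
          ← iteratedDeriv_eq_iterate, ← iteratedDeriv_eq_iterate, h2]
        exact ih d (by omega)
  obtain ⟨a, b, hab⟩ := exists_eq_exp_affine (C := C + 1) (B := B) hg hg0 fun z => by
    have h1 : 1 ≤ Real.exp (B * ‖z‖) := Real.one_le_exp (by positivity)
    have h2 := hb z
    rw [norm_pow] at h2
    rcases le_total ‖g z‖ 1 with h3 | h3
    · have := (pow_nonneg (norm_nonneg (g z)) n).trans h2
      nlinarith
    · have := le_self_pow₀ h3 hn0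
      nlinarith
  have ha : a ≠ 0 := fun h => hnc ⟨Complex.exp b, fun w => by rw [hab, h, zero_mul, zero_add]⟩
  have hFe : (fun w => g w ^ n) = fun w => Complex.exp ((n * a) * w + n * b) := by
    funext w
    rw [hab, ← Complex.exp_nat_mul]
    ring_nf
  have hc' : ∀ z, ((n * a) ^ k - c) * Complex.exp ((n * a) * z + n * b) = 1 - c := fun z => by
    have h1 := hc z
    rw [hFe, iteratedDeriv_cexp_affine, congrFun hFe z] at h1
    linear_combination h1
  have h0 := hc' (-b / a)
  have h2 := hc' ((-n * b + Real.log 2) / (n * a))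
  rw [show n * a * (-b / a) + n * b = 0 by field_simp; ring, Complex.exp_zero] at h0
  rw [show n * a * ((-n * b + Real.log 2) / (n * a)) + n * b = Real.log 2 by field_simp; ring,
    ← Complex.ofReal_exp, Real.exp_log two_pos] at h2
  have hk1 : (n * a) ^ k = 1 := by
    push_cast at h2
    linear_combination h0
  refine ⟨a⁻¹, inv_ne_zero ha, ?_, fun z => ?_⟩
  · rw [div_eq_mul_inv, ← mul_inv, mul_comm, inv_pow, hk1, inv_one]
  · have h1 := iteratedDeriv_cexp_affine 1 a b z
    rw [iteratedDeriv_one, pow_one, ← funext hab, ← hab] at h1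
    rw [h1, inv_mul_cancel_left₀ ha]

section SeveralVariables

variable {E : Type*} [NormedAddCommGroup E] [NormedSpace ℂ E]

theorem hasDerivAt_comp_line {f : E → ℂ} (hf : Differentiable ℂ f) (a v : E) (t : ℂ) :
    HasDerivAt (fun s : ℂ => f (a + s • v)) (fderiv ℂ f (a + t • v) v) t := by
  have h1 : HasDerivAt (fun s : ℂ => a + s • v) v t := by
    simpa using ((hasDerivAt_id t).smul_const v).const_add a
  exact (hf _).hasFDerivAt.comp_hasDerivAt t h1

theorem differentiable_comp_line {f : E → ℂ} (hf : Differentiable ℂ f) (a v : E) :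
    Differentiable ℂ (fun s : ℂ => f (a + s • v)) :=
  fun t => (hasDerivAt_comp_line hf a v t).differentiableAt

/-- Cauchy estimate: the derivative of an entire function is bounded on balls. -/
theorem exists_norm_fderiv_le_on_closedBall [FiniteDimensional ℂ E] {f : E → ℂ}
    (hf : Differentiable ℂ f) (R : ℝ) :
    ∃ C, ∀ w ∈ Metric.closedBall (0 : E) R, ‖fderiv ℂ f w‖ ≤ C := by
  have : ProperSpace E := FiniteDimensional.proper ℂ E
  obtain ⟨M, hM⟩ := (isCompact_closedBall (0 : E) (R + 1)).exists_bound_of_continuousOn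
    hf.continuous.continuousOn
  refine ⟨|M|, fun w hw => ?_⟩
  refine ContinuousLinearMap.opNorm_le_of_unit_norm (abs_nonneg M) fun v hv => ?_
  have hd := (hasDerivAt_comp_line hf w v 0).deriv
  rw [zero_smul, add_zero] at hd
  rw [← hd]
  refine (Complex.norm_deriv_le_of_forall_mem_sphere_norm_le one_pos
    (differentiable_comp_line hf w v).diffContOnCl (C := |M|) fun s hs => ?_).trans
    (div_one _).le
  refine (hM _ ?_).trans (le_abs_self M)
  rw [mem_closedBall_zero_iff] at hw ⊢
  rw [mem_sphere_zero_iff_norm] at hs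
  calc ‖w + s • v‖ ≤ ‖w‖ + ‖s‖ * ‖v‖ := (norm_add_le _ _).trans (by rw [norm_smul])
    _ ≤ R + 1 := by rw [hs, hv]; linarith

theorem differentiable_intervalIntegral_mul_comp_add [FiniteDimensional ℂ E] {f : E → ℂ}
    (hf : Differentiable ℂ f) {K : ℝ → ℂ} (hK : Continuous K) {γ : ℝ → E} (hγ : Continuous γ)
    (a b : ℝ) : Differentiable ℂ (fun z => ∫ θ in a..b, K θ * f (z + γ θ)) := by
  intro x
  obtain ⟨r, hr⟩ := (isCompact_uIcc (a := a) (b := b)).exists_bound_of_continuousOn hγ.continuousOn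
  obtain ⟨C, hC⟩ := exists_norm_fderiv_le_on_closedBall hf (‖x‖ + 1 + r)
  borelize E
  have : ProperSpace E := FiniteDimensional.proper ℂ E
  have : ProperSpace (E →L[ℂ] ℂ) := FiniteDimensional.proper ℂ _
  have hcont : ∀ z, Continuous fun θ => K θ * f (z + γ θ) := fun z =>
    hK.mul (hf.continuous.comp (continuous_const.add hγ))
  refine (intervalIntegral.hasFDerivAt_integral_of_dominated_of_fderiv_le (𝕜 := ℂ)
    (μ := MeasureTheory.volume)
    (F' := fun z θ => K θ • fderiv ℂ f (z + γ θ)) (bound := fun θ => ‖K θ‖ * C)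
    (Metric.ball_mem_nhds x one_pos) (.of_forall fun z => (hcont z).aestronglyMeasurable)
    ((hcont x).intervalIntegrable a b) ?_ ?_
    ((hK.norm.mul continuous_const).intervalIntegrable a b) ?_).differentiableAt
  · have h1 : Measurable fun θ => fderiv ℂ f (x + γ θ) :=
      (measurable_fderiv ℂ f).comp (continuous_const.add hγ).measurable
    exact hK.aestronglyMeasurable.smul h1.aestronglyMeasurable
  · refine .of_forall fun θ hθ z hz => ?_
    rw [norm_smul]
    refine mul_le_mul_of_nonneg_left (hC _ ?_) (norm_nonneg _)
    rw [mem_closedBall_zero_iff]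
    have h1 : ‖z - x‖ < 1 := by simpa [dist_eq_norm] using hz
    have h2 := hr θ (Set.uIoc_subset_uIcc hθ)
    calc ‖z + γ θ‖ = ‖x + (z - x) + γ θ‖ := by congr 1; abel
      _ ≤ ‖x‖ + ‖z - x‖ + ‖γ θ‖ := norm_add₃_le
      _ ≤ ‖x‖ + 1 + r := by linarith
  · refine .of_forall fun θ _ z _ => ?_
    have h1 : HasFDerivAt (fun w => f (w + γ θ)) (fderiv ℂ f (z + γ θ)) z :=
      (hasFDerivAt_comp_add_right _).2 (hf _).hasFDerivAt
    exact h1.const_mul (K θ)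

/-- Directional derivatives of an entire function of several variables are entire. -/
theorem differentiable_fderiv_apply [FiniteDimensional ℂ E] {f : E → ℂ}
    (hf : Differentiable ℂ f) (v : E) : Differentiable ℂ (fun z => fderiv ℂ f z v) := by
  have key : (fun z => fderiv ℂ f z v) = fun z => (2 * Real.pi * Complex.I : ℂ)⁻¹ *
      ∫ θ in (0 : ℝ)..2 * Real.pi, (circleMap 0 1 θ * Complex.I * ((circleMap 0 1 θ) ^ 2)⁻¹) *
        f (z + circleMap 0 1 θ • v) := by
    funext z
    have h1 := (hasDerivAt_comp_line hf z v 0).deriv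
    rw [zero_smul, add_zero] at h1
    rw [← h1, ← Complex.cderiv_eq_deriv isOpen_univ
      (differentiable_comp_line hf z v).differentiableOn one_pos (Set.subset_univ _)]
    simp only [Complex.cderiv, circleIntegral, deriv_circleMap, smul_eq_mul, sub_zero, mul_assoc]
  rw [key]
  refine (differentiable_intervalIntegral_mul_comp_add hf ?_ ?_ _ _).const_mul _
  · exact ((continuous_circleMap 0 1).mul continuous_const).mul
      (((continuous_circleMap 0 1).pow 2).inv₀ fun θ =>
        pow_ne_zero 2 (circleMap_ne_center one_ne_zero))
  · exact (continuous_circleMap 0 1).smul continuous_const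

/-- The ring of entire functions of several variables has no zero divisors. -/
theorem eq_zero_or_eq_zero_of_entire_mul_eq_zero {f g : E → ℂ} (hf : Differentiable ℂ f)
    (hg : Differentiable ℂ g) (h : ∀ z, f z * g z = 0) : (∀ z, f z = 0) ∨ ∀ z, g z = 0 := by
  by_contra! hcon
  obtain ⟨⟨a, ha⟩, b, hb⟩ := hcon
  have han : ∀ {F : E → ℂ}, Differentiable ℂ F →
      AnalyticOnNhd ℂ (fun s : ℂ => F (a + s • (b - a))) Set.univ := fun hF =>
    Complex.analyticOnNhd_univ_iff_differentiable.2 (differentiable_comp_line hF a (b - a))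
  rcases AnalyticOnNhd.eq_zero_or_eq_zero_of_smul_eq_zero (han hf) (han hg)
    (fun s _ => h _) isPreconnected_univ with h0 | h0
  · exact ha (by simpa using h0 0 (Set.mem_univ _))
  · exact hb (by simpa using h0 1 (Set.mem_univ _))

theorem differentiable_finset_prod_of_entire {ι : Type*} {F : ι → E → ℂ}
    (hF : ∀ i, Differentiable ℂ (F i)) (s : Finset ι) :
    Differentiable ℂ fun z => ∏ i ∈ s, F i z := by
  classical
  exact fun z => (HasFDerivAt.finsetProd fun i _ => (hF i z).hasFDerivAt).differentiableAt

theorem exists_eq_zero_of_entire_prod_eq_zero {ι : Type*} {F : ι → E → ℂ}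
    (hF : ∀ i, Differentiable ℂ (F i)) (s : Finset ι) (h : ∀ z, ∏ i ∈ s, F i z = 0) :
    ∃ i ∈ s, ∀ z, F i z = 0 := by
  classical
  induction s using Finset.induction_on with
  | empty => simp at h
  | insert i s hi ih =>
    simp only [Finset.prod_insert hi] at h
    rcases eq_zero_or_eq_zero_of_entire_mul_eq_zero (hF i)
      (differentiable_finset_prod_of_entire hF s) h with h0 | h0
    · exact ⟨i, Finset.mem_insert_self _ _, h0⟩
    · obtain ⟨j, hj, hj0⟩ := ih h0
      exact ⟨j, Finset.mem_insert_of_mem hj, hj0⟩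

end SeveralVariables

theorem differentiable_iterate_dirDeriv {m : ℕ} (u : Fin m → ℂ) {f : (Fin m → ℂ) → ℂ}
    (hf : Differentiable ℂ f) (k : ℕ) : Differentiable ℂ ((dirDeriv u)^[k] f) := by
  induction k with
  | zero => exact hf
  | succ k ih =>
    rw [Function.iterate_succ_apply']
    exact differentiable_fderiv_apply ih u

theorem iteratedDeriv_comp_line {m : ℕ} (u : Fin m → ℂ) {f : (Fin m → ℂ) → ℂ}
    (hf : Differentiable ℂ f) (k : ℕ) (a : Fin m → ℂ) :
    iteratedDeriv k (fun s : ℂ => f (a + s • u)) = fun t => (dirDeriv u)^[k] f (a + t • u) := by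
  induction k with
  | zero => simp
  | succ k ih =>
    rw [iteratedDeriv_succ, ih]
    funext t
    rw [Function.iterate_succ_apply']
    exact (hasDerivAt_comp_line (differentiable_iterate_dirDeriv u hf k) a u t).deriv

/-- Paper's Theorem 2.1. -/
theorem power_share_one_CM_entire (m : ℕ) (hm : 1 ≤ m) (f : (Fin m → ℂ) → ℂ)
    (hf : Differentiable ℂ f) (hnc : ¬∃ c : ℂ, ∀ z, f z = c)
    (u : Fin m → ℂ) (hu : ∑ j, Complex.normSq (u j) = 1)
    (k n : ℕ) (hk : 1 ≤ k) (hn : k + 1 ≤ n)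
    (hne : ¬∀ z, (dirDeriv u)^[k] (fun w => f w ^ n) z = 0)
    (hshare : ∃ φ : (Fin m → ℂ) → ℂ, Differentiable ℂ φ ∧ (∀ z, φ z ≠ 0) ∧
      ∀ z, (dirDeriv u)^[k] (fun w => f w ^ n) z - 1 = φ z * (f z ^ n - 1)) :
    ∃ c : ℂ, c ≠ 0 ∧ (c / (n : ℂ)) ^ k = 1 ∧ ∀ z, f z = c * dirDeriv u f z := by
  obtain ⟨φ, hφ, hφ0, h⟩ := hshare
  have hn0 : (n : ℂ) ≠ 0 := Nat.cast_ne_zero.2 (by omega)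
  have hfn : Differentiable ℂ fun w => f w ^ n := hf.fun_pow n
  have hDf : Differentiable ℂ (dirDeriv u f) := differentiable_fderiv_apply hf u
  have hline : ∀ z, dirDeriv u f z ≠ 0 →
      ∃ ω ∈ Polynomial.nthRootsFinset k (1 : ℂ), f z - n * ω * dirDeriv u f z = 0 := by
    intro z hz
    have hder : ∀ t, deriv (fun s : ℂ => f (z + s • u)) t = dirDeriv u f (z + t • u) :=
      fun t => (hasDerivAt_comp_line hf z u t).deriv
    obtain ⟨c, -, hck, hc⟩ := exists_eq_mul_deriv_of_share_one
      (differentiable_comp_line hf z u) (k := k) (n := n) (by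
        rintro ⟨c, hc⟩
        apply hz
        have h0 := hder 0
        rw [funext hc] at h0
        simpa using h0.symm) hk hn (differentiable_comp_line hφ z u) (fun _ => hφ0 _)
      (fun t => by rw [iteratedDeriv_comp_line u hfn k z]; exact h _)
    refine ⟨c / n, (Polynomial.mem_nthRootsFinset (by omega) _).2 hck, ?_⟩
    have h0 := hc 0
    rw [hder] at h0
    simp only [zero_smul, add_zero] at h0
    rw [mul_div_cancel₀ _ hn0, ← h0, sub_self]
  have hprod : ∀ z, (∏ ω ∈ Polynomial.nthRootsFinset k (1 : ℂ),
      (f z - n * ω * dirDeriv u f z)) * dirDeriv u f z = 0 := by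
    intro z
    by_cases hz : dirDeriv u f z = 0
    · rw [hz, mul_zero]
    · obtain ⟨ω, hω, h0⟩ := hline z hz
      rw [Finset.prod_eq_zero hω h0, zero_mul]
  have hfac : ∀ ω : ℂ, Differentiable ℂ fun z => f z - n * ω * dirDeriv u f z := fun ω =>
    hf.sub (hDf.const_mul _)
  rcases eq_zero_or_eq_zero_of_entire_mul_eq_zero
    (differentiable_finset_prod_of_entire hfac _) hDf hprod with h0 | h0
  · obtain ⟨ω, hω, hωz⟩ := exists_eq_zero_of_entire_prod_eq_zero hfac _ h0
    have hωk : ω ^ k = 1 := (Polynomial.mem_nthRootsFinset (by omega) _).1 hω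
    refine ⟨n * ω, mul_ne_zero hn0 ?_, ?_, fun z => sub_eq_zero.1 (hωz z)⟩
    · rintro rfl
      rw [zero_pow (by omega)] at hωk
      exact zero_ne_one hωk
    · rwa [mul_div_cancel_left₀ _ hn0]
  · refine absurd (fun z => ?_) hne
    have hconst : (fun s : ℂ => f (z + s • u)) = fun _ => f z := by
      funext s
      have := is_const_of_deriv_eq_zero (differentiable_comp_line hf z u)
        (fun t => (hasDerivAt_comp_line hf z u t).deriv.trans (h0 _)) s 0
      simpa using this
    have h1 := congrFun (iteratedDeriv_comp_line u hfn k z) 0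
    have h2 : (fun s : ℂ => f (z + s • u) ^ n) = fun _ => f z ^ n := by
      funext s
      rw [congrFun hconst s]
    rw [h2, iteratedDeriv_const, if_neg (by omega)] at h1
    simpa using h1.symm
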